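/- arXiv:1908.00421 — 7 statements merged into one kernel-verified Lean document; each statement's English description precedes it below -/
import Mathlib

section
/- Let g, g' be positive integers. Let Π ∈ M_{g×2g}(ℂ) and Π' ∈ M_{g'×2g'}(ℂ) be complex matrices, and let J ∈ M_{2g}(ℝ) and J' ∈ M_{2g'}(ℝ) be real matrices satisfying iΠ = ΠJ and iΠ' = Π'J'. Assume that the ℝ-linear maps ℝ^{2g} → ℂ^g, v ↦ Πv, and ℝ^{2g'} → ℂ^{g'}, v ↦ Π'v, are injective. Let E ∈ M_{2g}(ℤ) be an invertible matrix with Eᵗ = −E and JᵗEJ = E such that the Hermitian matrix iΠE⁻¹Π* is positive definite. Let T ∈ M_{g×g'}(ℂ) and R ∈ M_{2g×2g'}(ℤ) satisfy TΠ' = ΠR, and assume that R is injective as a ℚ-linear map ℚ^{2g'} → ℚ^{2g} (i.e. R has rank 2g'). Then the matrix E' := RᵗER satisfies: (E')ᵗ = −E', (J')ᵗE'J' = E', E' is invertible, and the Hermitian matrix iΠ'(E')⁻¹(Π')* is positive definite. -/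
open scoped ComplexOrder

open Matrix

theorem surjective_mulVec_ofReal_of_injective {ι κ : Type*} [Fintype ι] [Fintype κ]
    (hcard : Fintype.card κ = 2 * Fintype.card ι) {P : Matrix ι κ ℂ}
    (hP : Function.Injective fun v : κ → ℝ => P *ᵥ fun i => (v i : ℂ)) :
    Function.Surjective fun v : κ → ℝ => P *ᵥ fun i => (v i : ℂ) := by
  let L : (κ → ℝ) →ₗ[ℝ] (ι → ℂ) :=
    (P.mulVecLin.restrictScalars ℝ) ∘ₗ (Complex.ofRealCLM.toLinearMap.compLeft κ)
  have hfr : Module.finrank ℝ (κ → ℝ) = Module.finrank ℝ (ι → ℂ) := by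
    rw [Module.finrank_fintype_fun_eq_card, Module.finrank_pi_fintype]
    simp [Complex.finrank_real_complex, hcard, mul_comm]
  exact (LinearMap.injective_iff_surjective_of_finrank_eq_finrank (f := L) hfr).1 hP

theorem eq_zero_of_conjTranspose_mulVec_eq_zero {ι κ : Type*} [Fintype ι] [Fintype κ]
    (hcard : Fintype.card κ = 2 * Fintype.card ι) {P : Matrix ι κ ℂ}
    (hP : Function.Injective fun v : κ → ℝ => P *ᵥ fun i => (v i : ℂ))
    {w : ι → ℂ} (hw : Pᴴ *ᵥ w = 0) : w = 0 := by
  obtain ⟨v, hv⟩ := surjective_mulVec_ofReal_of_injective hcard hP w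
  have hv' : P *ᵥ (fun i => (v i : ℂ)) = w := hv
  rw [← dotProduct_star_self_eq_zero]
  nth_rw 2 [← hv']
  rw [dotProduct_mulVec]
  have : star w ᵥ* P = star (Pᴴ *ᵥ w) := by
    rw [star_mulVec, conjTranspose_conjTranspose]
  rw [this, hw]
  simp

/-- The imaginary part of `Pᴴ w` is obtained from its real part by `Jᵀ`. -/
theorem im_conjTranspose_mulVec {ι κ : Type*} [Fintype ι] [Fintype κ]
    {P : Matrix ι κ ℂ} {J : Matrix κ κ ℝ}
    (hJ : Complex.I • P = P * J.map Complex.ofReal) (w : ι → ℂ) (i : κ) :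
    ((Pᴴ *ᵥ w) i).im = (Jᵀ *ᵥ fun j => ((Pᴴ *ᵥ w) j).re) i := by
  have h := congrArg (fun M => (Mᴴ *ᵥ w) i) hJ
  simp only [conjTranspose_smul, conjTranspose_mul, ← mulVec_mulVec,
    smul_mulVec, Pi.smul_apply] at h
  have h' := congrArg Complex.re h
  generalize Pᴴ *ᵥ w = u at h' ⊢
  simpa [mulVec, dotProduct] using h'

theorem eq_of_mul_map_ofReal_eq {ι κ μ : Type*} [Fintype κ]
    {P : Matrix ι κ ℂ}
    (hP : Function.Injective fun v : κ → ℝ => P *ᵥ fun i => (v i : ℂ))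
    {M N : Matrix κ μ ℝ} (h : P * M.map Complex.ofReal = P * N.map Complex.ofReal) : M = N := by
  ext i j
  refine congrFun (hP (a₁ := M.col j) (a₂ := N.col j) ?_) i
  ext k
  exact congrFun (congrFun h k) j

theorem mul_self_eq_neg_one_of_I_smul_eq {ι κ : Type*} [Fintype κ] [DecidableEq κ]
    {P : Matrix ι κ ℂ} {J : Matrix κ κ ℝ}
    (hJ : Complex.I • P = P * J.map Complex.ofReal)
    (hP : Function.Injective fun v : κ → ℝ => P *ᵥ fun i => (v i : ℂ)) :
    J * J = -1 := by
  apply eq_of_mul_map_ofReal_eq hP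
  have h1 : (J * J).map Complex.ofReal = J.map Complex.ofReal * J.map Complex.ofReal :=
    Matrix.map_mul (f := Complex.ofRealHom)
  have h2 : (-1 : Matrix κ κ ℝ).map Complex.ofReal = -1 := by
    ext i j
    by_cases hij : i = j <;> simp [hij, one_apply]
  rw [h1, h2, ← Matrix.mul_assoc, ← hJ, smul_mul, ← hJ, smul_smul, Complex.I_mul_I]
  simp

theorem transpose_mul_eq_neg_mul {κ : Type*} [Fintype κ] [DecidableEq κ] {J A : Matrix κ κ ℝ}
    (hJJ : J * J = -1) (hAJ : Jᵀ * A * J = A) : Jᵀ * A = -(A * J) := by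
  rw [← hAJ, Matrix.mul_assoc _ J J, hJJ, hAJ]
  simp

theorem isUnit_det_map_ofReal {κ : Type*} [Fintype κ] [DecidableEq κ] {A : Matrix κ κ ℝ}
    (hA : A.det ≠ 0) : IsUnit (A.map Complex.ofReal).det := by
  have : (A.map Complex.ofReal).det = (A.det : ℂ) := (Complex.ofRealHom.map_det A).symm
  rw [this]
  exact isUnit_iff_ne_zero.2 (by exact_mod_cast hA)

/-- The Hermitian form of a polarization, expressed through the real form `Jᵀ A`. -/
theorem dotProduct_hermitianForm_eq {ι κ : Type*} [Fintype ι] [Fintype κ] [DecidableEq κ]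
    {P : Matrix ι κ ℂ} {J A : Matrix κ κ ℝ}
    (hJ : Complex.I • P = P * J.map Complex.ofReal) (hJJ : J * J = -1)
    (hA : A.det ≠ 0) (hAt : Aᵀ = -A) (hAJ : Jᵀ * A * J = A)
    {w : ι → ℂ} {x : κ → ℝ} (hx : (fun i => ((Pᴴ *ᵥ w) i).re) = A *ᵥ x) :
    star w ⬝ᵥ ((Complex.I • (P * (A.map Complex.ofReal)⁻¹ * Pᴴ)) *ᵥ w)
      = ((2 * (x ⬝ᵥ ((Jᵀ * A) *ᵥ x)) : ℝ) : ℂ) := by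
  have hanti := transpose_mul_eq_neg_mul hJJ hAJ
  let c : (κ → ℝ) → κ → ℂ := fun v i => (v i : ℂ)
  have hcd (u v : κ → ℝ) : c u ⬝ᵥ c v = ((u ⬝ᵥ v : ℝ) : ℂ) := by simp [c, dotProduct]
  have hcA (v : κ → ℝ) : A.map Complex.ofReal *ᵥ c v = c (A *ᵥ v) := by
    ext i; simp [c, mulVec, dotProduct]
  have hPw : Pᴴ *ᵥ w = c (A *ᵥ x) + Complex.I • c ((Jᵀ * A) *ᵥ x) := by
    ext i
    have h1 := congrFun hx i
    have h2 := im_conjTranspose_mulVec hJ w i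
    rw [hx, mulVec_mulVec] at h2
    rw [← Complex.re_add_im ((Pᴴ *ᵥ w) i), h2]
    rw [h1]
    simp [c, mul_comm]
  have hstar : star (Pᴴ *ᵥ w) = c (A *ᵥ x) - Complex.I • c ((Jᵀ * A) *ᵥ x) := by
    rw [hPw]
    ext i
    simp [c, sub_eq_add_neg]
  have hPw' : Pᴴ *ᵥ w = A.map Complex.ofReal *ᵥ (c x - Complex.I • c (J *ᵥ x)) := by
    rw [hPw, mulVec_sub, mulVec_smul, hcA, hcA, hanti, neg_mulVec, ← mulVec_mulVec]
    ext i
    simp [c, sub_eq_add_neg]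
  have hdet := isUnit_det_map_ofReal hA
  have hinv : (A.map Complex.ofReal)⁻¹ *ᵥ (Pᴴ *ᵥ w) = c x - Complex.I • c (J *ᵥ x) := by
    rw [hPw', mulVec_mulVec, nonsing_inv_mul _ hdet, one_mulVec]
  have hmain : star w ⬝ᵥ ((Complex.I • (P * (A.map Complex.ofReal)⁻¹ * Pᴴ)) *ᵥ w)
      = Complex.I * (star (Pᴴ *ᵥ w) ⬝ᵥ ((A.map Complex.ofReal)⁻¹ *ᵥ (Pᴴ *ᵥ w))) := by
    rw [smul_mulVec, dotProduct_smul, ← mulVec_mulVec, ← mulVec_mulVec, dotProduct_mulVec,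
      star_mulVec, conjTranspose_conjTranspose, smul_eq_mul]
  have ht (M : Matrix κ κ ℝ) (u v : κ → ℝ) : (M *ᵥ u) ⬝ᵥ v = u ⬝ᵥ (Mᵀ *ᵥ v) := by
    rw [dotProduct_mulVec, vecMul_transpose]
  have e1 : (A *ᵥ x) ⬝ᵥ x = 0 := by
    have h := ht A x x
    rw [hAt, neg_mulVec, dotProduct_neg, dotProduct_comm x] at h
    linarith
  have e2 : ((Jᵀ * A) *ᵥ x) ⬝ᵥ (J *ᵥ x) = 0 := by
    rw [← mulVec_mulVec, ht, transpose_transpose, mulVec_mulVec, hJJ, neg_mulVec, one_mulVec,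
      dotProduct_neg, e1, neg_zero]
  have e3 : (A *ᵥ x) ⬝ᵥ (J *ᵥ x) = x ⬝ᵥ ((Jᵀ * A) *ᵥ x) := by
    rw [← mulVec_mulVec, dotProduct_comm, ht]
  have e4 : ((Jᵀ * A) *ᵥ x) ⬝ᵥ x = x ⬝ᵥ ((Jᵀ * A) *ᵥ x) := dotProduct_comm _ _
  rw [hmain, hinv, hstar]
  simp only [sub_dotProduct, dotProduct_sub, smul_dotProduct, dotProduct_smul, hcd, e1, e2, e3, e4,
    smul_eq_mul]
  push_cast
  linear_combination (-2 * ((x ⬝ᵥ ((Jᵀ * A) *ᵥ x) : ℝ) : ℂ)) * Complex.I_mul_I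

theorem bijective_re_conjTranspose_mulVec {ι κ : Type*} [Fintype ι] [Fintype κ]
    (hcard : Fintype.card κ = 2 * Fintype.card ι)
    {P : Matrix ι κ ℂ} {J : Matrix κ κ ℝ}
    (hJ : Complex.I • P = P * J.map Complex.ofReal)
    (hP : Function.Injective fun v : κ → ℝ => P *ᵥ fun i => (v i : ℂ)) :
    Function.Bijective fun (w : ι → ℂ) (i : κ) => ((Pᴴ *ᵥ w) i).re := by
  let L : (ι → ℂ) →ₗ[ℝ] (κ → ℝ) :=
    (Complex.reCLM.toLinearMap.compLeft κ) ∘ₗ (Pᴴ.mulVecLin.restrictScalars ℝ)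
  have hfr : Module.finrank ℝ (ι → ℂ) = Module.finrank ℝ (κ → ℝ) := by
    rw [Module.finrank_fintype_fun_eq_card, Module.finrank_pi_fintype]
    simp [Complex.finrank_real_complex, hcard, mul_comm]
  have hinj : Function.Injective L := by
    rw [injective_iff_map_eq_zero]
    intro w hw
    have hre : (fun i => ((Pᴴ *ᵥ w) i).re) = 0 := hw
    apply eq_zero_of_conjTranspose_mulVec_eq_zero hcard hP
    ext i
    apply Complex.ext
    · exact congrFun hre i
    · rw [im_conjTranspose_mulVec hJ w i, hre, mulVec_zero]
      rfl
  exact ⟨hinj, (LinearMap.injective_iff_surjective_of_finrank_eq_finrank hfr).1 hinj⟩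

/-- Riemann's positivity condition `i P A⁻¹ Pᴴ > 0` is positivity of the real form `Jᵀ A`. -/
theorem posDef_hermitianForm_iff {ι κ : Type*} [Fintype ι] [Fintype κ] [DecidableEq κ]
    (hcard : Fintype.card κ = 2 * Fintype.card ι)
    {P : Matrix ι κ ℂ} {J A : Matrix κ κ ℝ}
    (hJ : Complex.I • P = P * J.map Complex.ofReal)
    (hP : Function.Injective fun v : κ → ℝ => P *ᵥ fun i => (v i : ℂ))
    (hA : A.det ≠ 0) (hAt : Aᵀ = -A) (hAJ : Jᵀ * A * J = A) :
    (Complex.I • (P * (A.map Complex.ofReal)⁻¹ * Pᴴ)).PosDef ↔ (Jᵀ * A).PosDef := by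
  have hJJ := mul_self_eq_neg_one_of_I_smul_eq hJ hP
  have hbij := bijective_re_conjTranspose_mulVec hcard hJ hP
  constructor
  · intro h
    refine .of_dotProduct_mulVec_pos ?_ fun x hx => ?_
    · rw [IsHermitian, conjTranspose_eq_transpose_of_trivial, transpose_mul, transpose_transpose,
        hAt, transpose_mul_eq_neg_mul hJJ hAJ, Matrix.neg_mul]
    · obtain ⟨w, hw⟩ := hbij.2 (A *ᵥ x)
      have hw0 : w ≠ 0 := by
        rintro rfl
        refine hx (mulVec_injective_of_det_ne_zero hA ?_)
        rw [← hw, mulVec_zero]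
        ext
        simp
      have := h.dotProduct_mulVec_pos hw0
      rw [dotProduct_hermitianForm_eq hJ hJJ hA hAt hAJ hw, Complex.zero_lt_real] at this
      rw [star_trivial]
      linarith
  · intro h
    refine .of_dotProduct_mulVec_pos ?_ fun w hw => ?_
    · have hAH : (A.map Complex.ofReal)ᴴ = -A.map Complex.ofReal := by
        ext i j
        have := congrFun (congrFun hAt i) j
        simp only [transpose_apply, Matrix.neg_apply] at this
        simp [this]
      have hneg : (-A.map Complex.ofReal)⁻¹ = -(A.map Complex.ofReal)⁻¹ :=
        inv_eq_left_inv (by rw [neg_mul_neg, nonsing_inv_mul _ (isUnit_det_map_ofReal hA)])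
      rw [IsHermitian, conjTranspose_smul, conjTranspose_mul, conjTranspose_mul,
        conjTranspose_conjTranspose, conjTranspose_nonsing_inv, hAH, hneg]
      simp [Matrix.mul_assoc]
    · have hu : IsUnit A.det := isUnit_iff_ne_zero.2 hA
      have hx : (fun i => ((Pᴴ *ᵥ w) i).re)
          = A *ᵥ (A⁻¹ *ᵥ fun i => ((Pᴴ *ᵥ w) i).re) := by
        rw [mulVec_mulVec, mul_nonsing_inv _ hu, one_mulVec]
      have hx0 : (A⁻¹ *ᵥ fun i => ((Pᴴ *ᵥ w) i).re) ≠ 0 := by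
        intro h0
        rw [h0, mulVec_zero] at hx
        refine hw (hbij.1 (hx.trans ?_))
        ext
        simp
      rw [dotProduct_hermitianForm_eq hJ hJJ hA hAt hAJ hx, Complex.zero_lt_real]
      have := h.dotProduct_mulVec_pos hx0
      rw [star_trivial] at this
      linarith

theorem injective_mulVec_map_intCast {m n : Type*} [Fintype m] [Fintype n] {R : Matrix m n ℤ}
    (hR : Function.Injective fun v : n → ℚ => (R.map (Int.cast : ℤ → ℚ)) *ᵥ v) :
    Function.Injective (R.map (Int.cast : ℤ → ℝ)).mulVec := by
  have h := Matrix.mulVec_injective_iff.1 hR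
  rw [← linearIndependent_algebraMap_comp_iff (S := ℝ)] at h
  rw [Matrix.mulVec_injective_iff]
  convert h using 1
  ext i j
  simp

/-- If `Pm` is a period matrix with complex structure `J` and polarization `E`,
and `(T, R)` is an inclusion (so `T Pm' = Pm R` with `R` of full rank `2g'`), then the
restriction `E' := Rᵗ E R` of `E` defines a polarization for `Pm'`. -/
theorem stmt_0 (g g' : ℕ) (hg : 0 < g) (hg' : 0 < g')
    (Pm : Matrix (Fin g) (Fin (2 * g)) ℂ)
    (Pm' : Matrix (Fin g') (Fin (2 * g')) ℂ)
    (J : Matrix (Fin (2 * g)) (Fin (2 * g)) ℝ)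
    (J' : Matrix (Fin (2 * g')) (Fin (2 * g')) ℝ)
    (hJ : Complex.I • Pm = Pm * J.map Complex.ofReal)
    (hJ' : Complex.I • Pm' = Pm' * J'.map Complex.ofReal)
    (hPm : Function.Injective fun v : Fin (2 * g) → ℝ => Pm.mulVec fun i => (v i : ℂ))
    (hPm' : Function.Injective fun v : Fin (2 * g') → ℝ => Pm'.mulVec fun i => (v i : ℂ))
    (E : Matrix (Fin (2 * g)) (Fin (2 * g)) ℤ)
    (hEdet : E.det ≠ 0)
    (hEalt : E.transpose = -E)
    (hEJ : J.transpose * E.map (Int.cast : ℤ → ℝ) * J = E.map (Int.cast : ℤ → ℝ))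
    (hEpos : (Complex.I • (Pm * (E.map (Int.cast : ℤ → ℂ))⁻¹ * Pm.conjTranspose)).PosDef)
    (T : Matrix (Fin g) (Fin g') ℂ)
    (R : Matrix (Fin (2 * g)) (Fin (2 * g')) ℤ)
    (hTR : T * Pm' = Pm * R.map (Int.cast : ℤ → ℂ))
    (hRinj : Function.Injective fun v : Fin (2 * g') → ℚ =>
      (R.map (Int.cast : ℤ → ℚ)).mulVec v) :
    (R.transpose * E * R).transpose = -(R.transpose * E * R) ∧
    J'.transpose * (R.transpose * E * R).map (Int.cast : ℤ → ℝ) * J'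
      = (R.transpose * E * R).map (Int.cast : ℤ → ℝ) ∧
    (R.transpose * E * R).det ≠ 0 ∧
    (Complex.I • (Pm' * ((R.transpose * E * R).map (Int.cast : ℤ → ℂ))⁻¹
      * Pm'.conjTranspose)).PosDef := by
  set E' := R.transpose * E * R with hE'
  have hcast : (Int.cast : ℤ → ℂ) = Complex.ofReal ∘ (Int.cast : ℤ → ℝ) := by
    ext; simp
  have hmap {m n : Type} (M : Matrix m n ℤ) : M.map (Int.cast : ℤ → ℂ)
      = (M.map (Int.cast : ℤ → ℝ)).map Complex.ofReal := by
    rw [hcast, Matrix.map_map]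
  have hdet {n : ℕ} (M : Matrix (Fin n) (Fin n) ℤ) :
      (M.map (Int.cast : ℤ → ℝ)).det = (M.det : ℝ) := ((Int.castRingHom ℝ).map_det M).symm
  have hneg {n : ℕ} {M : Matrix (Fin n) (Fin n) ℤ} (h : Mᵀ = -M) :
      (M.map (Int.cast : ℤ → ℝ))ᵀ = -M.map (Int.cast : ℤ → ℝ) := by
    rw [← transpose_map, h]
    ext
    simp
  have hE'R : E'.map (Int.cast : ℤ → ℝ) = (R.map (Int.cast : ℤ → ℝ))ᵀ
      * E.map (Int.cast : ℤ → ℝ) * R.map (Int.cast : ℤ → ℝ) := by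
    change (Rᵀ * E * R).map (Int.castRingHom ℝ) = _
    rw [Matrix.map_mul, Matrix.map_mul]
    rfl
  have hRJ : J * R.map (Int.cast : ℤ → ℝ) = R.map (Int.cast : ℤ → ℝ) * J' := by
    apply eq_of_mul_map_ofReal_eq hPm
    have h1 : (J * R.map (Int.cast : ℤ → ℝ)).map Complex.ofReal
        = J.map Complex.ofReal * (R.map (Int.cast : ℤ → ℝ)).map Complex.ofReal :=
      Matrix.map_mul (f := Complex.ofRealHom)
    have h2 : (R.map (Int.cast : ℤ → ℝ) * J').map Complex.ofReal
        = (R.map (Int.cast : ℤ → ℝ)).map Complex.ofReal * J'.map Complex.ofReal :=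
      Matrix.map_mul (f := Complex.ofRealHom)
    rw [h1, h2, ← Matrix.mul_assoc, ← Matrix.mul_assoc, ← hJ, ← hmap, smul_mul, ← hTR,
      Matrix.mul_assoc, ← hJ', Matrix.mul_smul]
  have hRJt : J'ᵀ * (R.map (Int.cast : ℤ → ℝ))ᵀ = (R.map (Int.cast : ℤ → ℝ))ᵀ * Jᵀ := by
    rw [← transpose_mul, ← hRJ, transpose_mul]
  have halt : E'ᵀ = -E' := by
    rw [hE', transpose_mul, transpose_mul, transpose_transpose, hEalt]
    simp [Matrix.mul_assoc]
  have hform : J'ᵀ * E'.map (Int.cast : ℤ → ℝ) = (R.map (Int.cast : ℤ → ℝ))ᵀ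
      * (Jᵀ * E.map (Int.cast : ℤ → ℝ)) * R.map (Int.cast : ℤ → ℝ) := by
    simp only [hE'R, ← Matrix.mul_assoc, hRJt]
  have hE'J : J'ᵀ * E'.map (Int.cast : ℤ → ℝ) * J' = E'.map (Int.cast : ℤ → ℝ) := by
    rw [hform, Matrix.mul_assoc, ← hRJ, ← Matrix.mul_assoc, Matrix.mul_assoc _ _ J, hEJ, hE'R]
  have hpos : (Jᵀ * E.map (Int.cast : ℤ → ℝ)).PosDef := by
    rw [hmap] at hEpos
    exact (posDef_hermitianForm_iff (by simp) hJ hPm (by rw [hdet]; exact_mod_cast hEdet)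
      (hneg hEalt) hEJ).1 hEpos
  have hpos' : (J'ᵀ * E'.map (Int.cast : ℤ → ℝ)).PosDef := by
    rw [hform, ← conjTranspose_eq_transpose_of_trivial (R.map _)]
    exact hpos.conjTranspose_mul_mul_same (injective_mulVec_map_intCast hRinj)
  have hdet' : (E'.map (Int.cast : ℤ → ℝ)).det ≠ 0 := by
    have h := (isUnit_iff_isUnit_det _).1 hpos'.isUnit
    rw [det_mul] at h
    exact right_ne_zero_of_mul h.ne_zero
  refine ⟨halt, hE'J, ?_, ?_⟩
  · rw [hdet] at hdet'
    exact_mod_cast hdet'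
  · rw [hmap]
    exact (posDef_hermitianForm_iff (by simp) hJ' hPm' hdet' (hneg halt) hE'J).2 hpos'
end

section
/- Let g, g' be positive integers. Let Π ∈ M_{g×2g}(ℂ) and Π' ∈ M_{g'×2g'}(ℂ) be complex matrices, and let J ∈ M_{2g}(ℝ) and J' ∈ M_{2g'}(ℝ) be real matrices satisfying iΠ = ΠJ and iΠ' = Π'J'. Assume that the ℝ-linear maps ℝ^{2g} → ℂ^g, v ↦ Πv, and ℝ^{2g'} → ℂ^{g'}, v ↦ Π'v, are injective. Let E ∈ M_{2g}(ℤ) be an invertible matrix with Eᵗ = −E and JᵗEJ = E such that the Hermitian matrix iΠE⁻¹Π* is positive definite. Let T ∈ M_{g'×g}(ℂ) and R ∈ M_{2g'×2g}(ℤ) satisfy TΠ = Π'R, and assume that R is surjective as a ℚ-linear map ℚ^{2g} → ℚ^{2g'} (i.e. R has rank 2g'). Then the rational matrix M := RE⁻¹Rᵗ is invertible and satisfies Mᵗ = −M and (J')ᵗM⁻¹J' = M⁻¹, and the Hermitian matrix iΠ'M(Π')* is positive definite; consequently, there is a positive integer n such that E' := nM⁻¹ has integer entries, (E')ᵗ =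 −E', (J')ᵗE'J' = E', and iΠ'(E')⁻¹(Π')* is positive definite. -/
open scoped ComplexOrder

namespace Matrix

variable {m n K L : Type*} [Fintype n] [Field K] [Field L]

theorem exists_nat_smul_eq_intCast [Fintype m] (A : Matrix m n ℚ) :
    ∃ k : ℕ, 0 < k ∧ ∃ B : Matrix m n ℤ, B.map (Int.cast : ℤ → ℚ) = (k : ℚ) • A := by
  refine ⟨∏ p : m × n, (A p.1 p.2).den, Finset.prod_pos fun p _ => (A p.1 p.2).den_pos, ?_⟩
  have hval : ∀ i j, ∃ z : ℤ, (z : ℚ) = ((∏ p : m × n, (A p.1 p.2).den : ℕ) : ℚ) * A i j := by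
    intro i j
    obtain ⟨c, hc⟩ := Finset.dvd_prod_of_mem (fun p : m × n => (A p.1 p.2).den)
      (Finset.mem_univ (i, j))
    refine ⟨c * (A i j).num, ?_⟩
    rw [hc]
    push_cast
    rw [mul_right_comm, mul_comm ((A i j).den : ℚ), Rat.mul_den_eq_num, mul_comm]
  choose z hz using hval
  exact ⟨of z, by ext i j; simpa using hz i j⟩

theorem dotProduct_mulVec_self_of_transpose_eq_neg [CharZero K] {A : Matrix n n K}
    (hA : Aᵀ = -A) (x : n → K) : x ⬝ᵥ A *ᵥ x = 0 := by
  have h : x ⬝ᵥ A *ᵥ x = -(x ⬝ᵥ A *ᵥ x) := by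
    conv_lhs => rw [dotProduct_mulVec, ← mulVec_transpose, hA, dotProduct_comm, neg_mulVec,
      dotProduct_neg]
  exact self_eq_neg.mp h

variable [DecidableEq n]

theorem map_inv_of_det_ne_zero (f : K →+* L) {A : Matrix n n K} (hA : A.det ≠ 0) :
    (A.map f)⁻¹ = A⁻¹.map f := by
  refine inv_eq_right_inv ?_
  rw [← Matrix.map_mul, mul_nonsing_inv _ (isUnit_iff_ne_zero.mpr hA)]
  exact Matrix.map_one f f.map_zero f.map_one

theorem det_map_ringHom_ne_zero_iff {R S : Type*} [CommRing R] [CommRing S] {f : R →+* S}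
    (hf : Function.Injective f) {A : Matrix n n R} : (A.map f).det ≠ 0 ↔ A.det ≠ 0 := by
  rw [← RingHom.mapMatrix_apply, ← RingHom.map_det, Ne, map_eq_zero_iff f hf]

theorem transpose_mul_inv_mul_of_mul_mul_transpose {A B : Matrix n n K} (hB : B.det ≠ 0)
    (h : A * B * Aᵀ = B) : Aᵀ * B⁻¹ * A = B⁻¹ := by
  have hA : IsUnit A.det := by
    refine isUnit_iff_ne_zero.mpr fun h0 => hB ?_
    rw [← h, det_mul, det_mul, h0, zero_mul, zero_mul]
  refine (inv_eq_right_inv ?_).symm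
  have hcancel : A * (B * (Aᵀ * B⁻¹ * A)) = A * 1 := by
    rw [← Matrix.mul_assoc, ← Matrix.mul_assoc, ← Matrix.mul_assoc, h,
      mul_nonsing_inv _ (isUnit_iff_ne_zero.mpr hB), Matrix.one_mul, Matrix.mul_one]
  simpa [nonsing_inv_mul_cancel_left _ _ hA, nonsing_inv_mul _ hA] using congrArg (A⁻¹ * ·) hcancel

theorem inv_transpose_eq_neg {A : Matrix n n K} (hA : A.det ≠ 0) (h : Aᵀ = -A) :
    (A⁻¹)ᵀ = -A⁻¹ := by
  rw [transpose_nonsing_inv, h]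
  refine inv_eq_right_inv ?_
  rw [neg_mul_neg, mul_nonsing_inv _ (isUnit_iff_ne_zero.mpr hA)]

end Matrix

open Matrix

section PeriodMatrix

variable {g : ℕ} {P : Matrix (Fin g) (Fin (2 * g)) ℂ}

theorem periodMatrix_surjective
    (hP : Function.Injective fun v : Fin (2 * g) → ℝ => P *ᵥ fun i => (v i : ℂ)) :
    Function.Surjective fun v : Fin (2 * g) → ℝ => P *ᵥ fun i => (v i : ℂ) := by
  let f : (Fin (2 * g) → ℝ) →ₗ[ℝ] (Fin g → ℂ) :=
    (P.mulVecLin.restrictScalars ℝ).comp (Complex.ofRealCLM.toLinearMap.compLeft _)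
  have hrank : Module.finrank ℝ (Fin (2 * g) → ℝ) = Module.finrank ℝ (Fin g → ℂ) := by
    simp [Module.finrank_pi_fintype, mul_comm]
  exact (LinearMap.injective_iff_surjective_of_finrank_eq_finrank (f := f) hrank).mp hP

theorem periodMatrix_re_conjTranspose_surjective
    (hP : Function.Injective fun v : Fin (2 * g) → ℝ => P *ᵥ fun i => (v i : ℂ)) :
    Function.Surjective fun (w : Fin g → ℂ) i => ((Pᴴ *ᵥ w) i).re := by
  let f : (Fin g → ℂ) →ₗ[ℝ] (Fin (2 * g) → ℝ) :=
    (Complex.reCLM.toLinearMap.compLeft _).comp (Pᴴ.mulVecLin.restrictScalars ℝ)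
  have hrank : Module.finrank ℝ (Fin g → ℂ) = Module.finrank ℝ (Fin (2 * g) → ℝ) := by
    simp [Module.finrank_pi_fintype, mul_comm]
  refine (LinearMap.injective_iff_surjective_of_finrank_eq_finrank (f := f) hrank).mp ?_
  refine (injective_iff_map_eq_zero f).mpr fun w hw => ?_
  obtain ⟨u, rfl⟩ := periodMatrix_surjective hP w
  set c : Fin (2 * g) → ℂ := fun i => (u i : ℂ)
  have hre : (c ⬝ᵥ Pᴴ *ᵥ (P *ᵥ c)).re = 0 := by
    rw [dotProduct, Complex.re_sum]
    refine Finset.sum_eq_zero fun i _ => ?_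
    have hi : ((Pᴴ *ᵥ (P *ᵥ c)) i).re = 0 := congrFun hw i
    rw [Complex.re_ofReal_mul, hi, mul_zero]
  have hc : star c = c := by ext i; simp [c]
  have hnorm : c ⬝ᵥ Pᴴ *ᵥ (P *ᵥ c) = star (P *ᵥ c) ⬝ᵥ (P *ᵥ c) := by
    rw [star_mulVec, hc, dotProduct_mulVec]
  rw [hnorm] at hre
  have hnonneg := dotProduct_star_self_nonneg (P *ᵥ c)
  exact dotProduct_star_self_eq_zero.mp (Complex.ext hre (Complex.nonneg_iff.mp hnonneg).2.symm)

theorem eq_zero_of_vecMul_periodMatrix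
    (hP : Function.Injective fun v : Fin (2 * g) → ℝ => P *ᵥ fun i => (v i : ℂ))
    {w : Fin g → ℂ} (hw : w ᵥ* P = 0) : w = 0 := by
  obtain ⟨u, hu⟩ := periodMatrix_surjective hP (star w)
  refine dotProduct_self_star_eq_zero.mp ?_
  rw [← hu, dotProduct_mulVec, hw, zero_dotProduct]

theorem periodMatrix_mul_ofReal_injective {k : Type*}
    (hP : Function.Injective fun v : Fin (2 * g) → ℝ => P *ᵥ fun i => (v i : ℂ))
    {A B : Matrix (Fin (2 * g)) k ℝ}
    (h : P * A.map Complex.ofReal = P * B.map Complex.ofReal) : A = B := by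
  ext i j
  refine congrFun (hP (a₁ := fun i => A i j) (a₂ := fun i => B i j) ?_) i
  ext r
  exact congrFun (congrFun h r) j

theorem det_ne_zero_of_posDef_periodMatrix
    (hP : Function.Injective fun v : Fin (2 * g) → ℝ => P *ᵥ fun i => (v i : ℂ))
    {A : Matrix (Fin (2 * g)) (Fin (2 * g)) ℝ} (hA : Aᵀ = -A)
    (hpos : (Complex.I • (P * A.map Complex.ofReal * Pᴴ)).PosDef) : A.det ≠ 0 := by
  intro hdet
  obtain ⟨v, hv0, hv⟩ := exists_mulVec_eq_zero_iff.mpr hdet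
  obtain ⟨w, hw⟩ := periodMatrix_re_conjTranspose_surjective hP ((1 / 2 : ℝ) • v)
  set B := A.map Complex.ofReal
  have hB : Bᵀ = -B := by
    ext i j
    have := congrFun (congrFun hA i) j
    simp only [transpose_apply] at this
    simp [B, this]
  set x := Pᴴ *ᵥ w
  have hx : x + star x = fun i => (v i : ℂ) := by
    ext i
    have hi : (x i).re = 1 / 2 * v i := congrFun hw i
    have hconj : x i + star (x i) = ((2 * (x i).re : ℝ) : ℂ) := Complex.add_conj _
    rw [Pi.add_apply, Pi.star_apply, hconj, hi]
    push_cast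
    ring
  have hBv : B *ᵥ (x + star x) = 0 := by
    rw [hx]
    ext i
    have hi : (A *ᵥ v) i = 0 := congrFun hv i
    have hcast := congrArg Complex.ofReal hi
    simpa [B, mulVec, dotProduct] using hcast
  have hform : star x ⬝ᵥ B *ᵥ x = 0 := by
    have h := congrArg (star x ⬝ᵥ ·) hBv
    simpa [mulVec_add, dotProduct_add,
      dotProduct_mulVec_self_of_transpose_eq_neg hB (star x)] using h
  have hw0 : w = 0 := by
    by_contra hne
    have h := hpos.dotProduct_mulVec_pos hne
    have heq : star w ⬝ᵥ (Complex.I • (P * B * Pᴴ)) *ᵥ w = Complex.I * (star x ⬝ᵥ B *ᵥ x) := by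
      rw [smul_mulVec, dotProduct_smul, smul_eq_mul, ← mulVec_mulVec, ← mulVec_mulVec,
        dotProduct_mulVec (star w) P, star_mulVec, conjTranspose_conjTranspose]
    rw [heq, hform, mul_zero] at h
    exact lt_irrefl _ h
  refine hv0 (funext fun i => ?_)
  have hi := congrFun hx i
  simpa [x, hw0] using hi.symm

end PeriodMatrix

/-- If `Pm` is a period matrix with complex structure `J` and polarization `E`,
and `(T, R)` is a projection onto the quotient with period matrix `Pm'` (so `T Pm = Pm' R`
with `R` surjective of rank `2g'`), then `M := R E⁻¹ Rᵗ` is invertible, alternating and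
compatible with `J'`, the Hermitian matrix `i Pm' M (Pm')*` is positive definite, and an
integer multiple `E' := n M⁻¹` induces a polarization on `Pm'`. -/
theorem stmt_1 (g g' : ℕ) (hg : 0 < g) (hg' : 0 < g')
    (Pm : Matrix (Fin g) (Fin (2 * g)) ℂ)
    (Pm' : Matrix (Fin g') (Fin (2 * g')) ℂ)
    (J : Matrix (Fin (2 * g)) (Fin (2 * g)) ℝ)
    (J' : Matrix (Fin (2 * g')) (Fin (2 * g')) ℝ)
    (hJ : Complex.I • Pm = Pm * J.map Complex.ofReal)
    (hJ' : Complex.I • Pm' = Pm' * J'.map Complex.ofReal)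
    (hPm : Function.Injective fun v : Fin (2 * g) → ℝ => Pm.mulVec fun i => (v i : ℂ))
    (hPm' : Function.Injective fun v : Fin (2 * g') → ℝ => Pm'.mulVec fun i => (v i : ℂ))
    (E : Matrix (Fin (2 * g)) (Fin (2 * g)) ℤ)
    (hEdet : E.det ≠ 0)
    (hEalt : E.transpose = -E)
    (hEJ : J.transpose * E.map (Int.cast : ℤ → ℝ) * J = E.map (Int.cast : ℤ → ℝ))
    (hEpos : (Complex.I • (Pm * (E.map (Int.cast : ℤ → ℂ))⁻¹ * Pm.conjTranspose)).PosDef)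
    (T : Matrix (Fin g') (Fin g) ℂ)
    (R : Matrix (Fin (2 * g')) (Fin (2 * g)) ℤ)
    (hTR : T * Pm = Pm' * R.map (Int.cast : ℤ → ℂ))
    (hRsurj : Function.Surjective fun v : Fin (2 * g) → ℚ =>
      (R.map (Int.cast : ℤ → ℚ)).mulVec v)
    (M : Matrix (Fin (2 * g')) (Fin (2 * g')) ℚ)
    (hM : M = R.map (Int.cast : ℤ → ℚ) * (E.map (Int.cast : ℤ → ℚ))⁻¹
      * (R.map (Int.cast : ℤ → ℚ)).transpose) :
    M.det ≠ 0 ∧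
    M.transpose = -M ∧
    J'.transpose * (M⁻¹).map (Rat.cast : ℚ → ℝ) * J' = (M⁻¹).map (Rat.cast : ℚ → ℝ) ∧
    (Complex.I • (Pm' * M.map (Rat.cast : ℚ → ℂ) * Pm'.conjTranspose)).PosDef ∧
    ∃ n : ℕ, 0 < n ∧ ∃ E' : Matrix (Fin (2 * g')) (Fin (2 * g')) ℤ,
      E'.map (Int.cast : ℤ → ℚ) = (n : ℚ) • M⁻¹ ∧
      E'.transpose = -E' ∧
      J'.transpose * E'.map (Int.cast : ℤ → ℝ) * J' = E'.map (Int.cast : ℤ → ℝ) ∧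
      (Complex.I • (Pm' * (E'.map (Int.cast : ℤ → ℂ))⁻¹ * Pm'.conjTranspose)).PosDef := by
  have hEQ : (E.map (Int.cast : ℤ → ℚ)).det ≠ 0 :=
    (det_map_ringHom_ne_zero_iff (f := Int.castRingHom ℚ) Int.cast_injective).mpr hEdet
  have hER : (E.map (Int.cast : ℤ → ℝ)).det ≠ 0 :=
    (det_map_ringHom_ne_zero_iff (f := Int.castRingHom ℝ) Int.cast_injective).mpr hEdet
  have hMcast : ∀ {K : Type} [Field K] [CharZero K], M.map (Rat.cast : ℚ → K) =
      R.map (Int.cast : ℤ → K) * (E.map (Int.cast : ℤ → K))⁻¹ *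
        (R.map (Int.cast : ℤ → K))ᵀ := by
    intro K _ _
    have hE := map_inv_of_det_ne_zero (Rat.castHom K) hEQ
    have hval : ∀ {a b : Type} (X : Matrix a b ℤ),
        (X.map (Int.cast : ℤ → ℚ)).map (Rat.castHom K) = X.map (Int.cast : ℤ → K) := by
      intro a b X
      ext i j
      simp
    change M.map (Rat.castHom K) = _
    rw [hM, Matrix.map_mul, Matrix.map_mul, ← hE, transpose_map, hval, hval]
  have hMalt : Mᵀ = -M := by
    have hE : (E.map (Int.cast : ℤ → ℚ))ᵀ = -E.map (Int.cast : ℤ → ℚ) := by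
      rw [← transpose_map, hEalt]
      ext i j
      simp
    rw [hM, transpose_mul, transpose_mul, transpose_transpose, inv_transpose_eq_neg hEQ hE,
      Matrix.neg_mul, Matrix.mul_neg, Matrix.mul_assoc]
  have hpos : (Complex.I • (Pm' * M.map (Rat.cast : ℚ → ℂ) * Pm'ᴴ)).PosDef := by
    obtain ⟨S, hS⟩ := mulVec_surjective_iff_exists_right_inverse.mp hRsurj
    have hRS : R.map (Int.cast : ℤ → ℂ) * S.map (Rat.castHom ℂ) = 1 := by
      have h := congrArg (fun X => X.map (Rat.castHom ℂ)) hS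
      simp only [Matrix.map_mul, Matrix.map_map] at h
      rw [Matrix.map_one _ (map_zero _) (map_one _)] at h
      rw [← h]
      congr 1
    have hT : Function.Injective T.vecMul := by
      refine (injective_iff_map_eq_zero T.vecMulLinear).mpr fun w hw => ?_
      have hw' : w ᵥ* T = 0 := hw
      refine eq_zero_of_vecMul_periodMatrix hPm' ?_
      rw [← Matrix.mul_one Pm', ← hRS, ← Matrix.mul_assoc, ← hTR, ← vecMul_vecMul,
        ← vecMul_vecMul, hw', zero_vecMul, zero_vecMul]
    have hconj : Pm' * M.map (Rat.cast : ℚ → ℂ) * Pm'ᴴ =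
        T * (Pm * (E.map (Int.cast : ℤ → ℂ))⁻¹ * Pmᴴ) * Tᴴ := by
      have hRH : (R.map (Int.cast : ℤ → ℂ))ᵀ = (R.map (Int.cast : ℤ → ℂ))ᴴ := by
        ext i j
        simp
      have hTRH := congrArg conjTranspose hTR
      rw [conjTranspose_mul, conjTranspose_mul] at hTRH
      rw [hMcast, hRH]
      calc _ = (Pm' * R.map (Int.cast : ℤ → ℂ)) * (E.map (Int.cast : ℤ → ℂ))⁻¹ *
            ((R.map (Int.cast : ℤ → ℂ))ᴴ * Pm'ᴴ) := by simp only [Matrix.mul_assoc]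
        _ = _ := by rw [← hTR, ← hTRH]; simp only [Matrix.mul_assoc]
    rw [hconj, ← Matrix.smul_mul, ← Matrix.mul_smul]
    exact hEpos.mul_mul_conjTranspose_same hT
  have hMR : (M.map (Rat.cast : ℚ → ℝ)).det ≠ 0 := by
    refine det_ne_zero_of_posDef_periodMatrix hPm' ?_ ?_
    · rw [← transpose_map, hMalt]
      ext i j
      simp
    · have hcast : (M.map (Rat.cast : ℚ → ℝ)).map Complex.ofReal = M.map (Rat.cast : ℚ → ℂ) := by
        ext i j
        simp
      rwa [hcast]
  have hMdet : M.det ≠ 0 :=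
    (det_map_ringHom_ne_zero_iff (f := Rat.castHom ℝ) Rat.cast_injective).mp hMR
  have hRJ : R.map (Int.cast : ℤ → ℝ) * J = J' * R.map (Int.cast : ℤ → ℝ) := by
    refine periodMatrix_mul_ofReal_injective hPm' ?_
    have hcast : (R.map (Int.cast : ℤ → ℝ)).map Complex.ofRealHom =
        R.map (Int.cast : ℤ → ℂ) := by
      ext i j
      simp
    change Pm' * (R.map (Int.cast : ℤ → ℝ) * J).map Complex.ofRealHom =
      Pm' * (J' * R.map (Int.cast : ℤ → ℝ)).map Complex.ofRealHom
    rw [Matrix.map_mul, Matrix.map_mul, hcast, ← Matrix.mul_assoc, ← Matrix.mul_assoc, ← hTR]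
    change T * Pm * J.map Complex.ofReal = Pm' * J'.map Complex.ofReal * _
    rw [← hJ', Matrix.mul_assoc, ← hJ, Matrix.mul_smul, Matrix.smul_mul, hTR]
  have hMJ : J'ᵀ * M⁻¹.map (Rat.cast : ℚ → ℝ) * J' = M⁻¹.map (Rat.cast : ℚ → ℝ) := by
    have hE : J * (E.map (Int.cast : ℤ → ℝ))⁻¹ * Jᵀ = (E.map (Int.cast : ℤ → ℝ))⁻¹ := by
      simpa using transpose_mul_inv_mul_of_mul_mul_transpose (A := Jᵀ) hER (by simpa using hEJ)
    have hinv : M⁻¹.map (Rat.cast : ℚ → ℝ) = (M.map (Rat.cast : ℚ → ℝ))⁻¹ :=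
      (map_inv_of_det_ne_zero (Rat.castHom ℝ) hMdet).symm
    rw [hinv]
    refine transpose_mul_inv_mul_of_mul_mul_transpose hMR ?_
    have hRJt := congrArg transpose hRJ
    rw [transpose_mul, transpose_mul] at hRJt
    rw [hMcast]
    calc _ = (J' * R.map (Int.cast : ℤ → ℝ)) * (E.map (Int.cast : ℤ → ℝ))⁻¹ *
          ((R.map (Int.cast : ℤ → ℝ))ᵀ * J'ᵀ) := by simp only [Matrix.mul_assoc]
      _ = R.map (Int.cast : ℤ → ℝ) * (J * (E.map (Int.cast : ℤ → ℝ))⁻¹ * Jᵀ) *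
          (R.map (Int.cast : ℤ → ℝ))ᵀ := by
        rw [← hRJ, ← hRJt]
        simp only [Matrix.mul_assoc]
      _ = _ := by rw [hE]
  refine ⟨hMdet, hMalt, hMJ, hpos, ?_⟩
  obtain ⟨n, hn, E', hE'⟩ := exists_nat_smul_eq_intCast M⁻¹
  have hE'cast : ∀ {K : Type} [Field K] [CharZero K],
      E'.map (Int.cast : ℤ → K) = (n : K) • M⁻¹.map (Rat.cast : ℚ → K) := by
    intro K _ _
    ext i j
    have h := congrArg (Rat.cast : ℚ → K) (congrFun (congrFun hE' i) j)
    simpa using h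
  refine ⟨n, hn, E', hE', ?_, ?_, ?_⟩
  · refine Matrix.map_injective (Int.cast_injective (α := ℚ)) ?_
    change E'ᵀ.map (Int.cast : ℤ → ℚ) = (-E').map (Int.cast : ℤ → ℚ)
    have hneg : (-E').map (Int.cast : ℤ → ℚ) = -E'.map (Int.cast : ℤ → ℚ) := by
      ext i j
      simp
    rw [hneg, transpose_map, hE', transpose_smul, inv_transpose_eq_neg hMdet hMalt, smul_neg]
  · rw [hE'cast, Matrix.mul_smul, Matrix.smul_mul, hMJ]
  · have hn0 : (n : ℂ) ≠ 0 := Nat.cast_ne_zero.mpr hn.ne'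
    have hMC : (M.map (Rat.castHom ℂ)).det ≠ 0 :=
      (det_map_ringHom_ne_zero_iff Rat.cast_injective).mpr hMdet
    have hinv : (E'.map (Int.cast : ℤ → ℂ))⁻¹ = (n : ℂ)⁻¹ • M.map (Rat.cast : ℚ → ℂ) := by
      refine inv_eq_left_inv ?_
      have h : M⁻¹.map (Rat.cast : ℚ → ℂ) = (M.map (Rat.castHom ℂ))⁻¹ :=
        (map_inv_of_det_ne_zero (Rat.castHom ℂ) hMdet).symm
      rw [hE'cast, h, Matrix.smul_mul, Matrix.mul_smul, smul_smul, inv_mul_cancel₀ hn0, one_smul]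
      exact mul_nonsing_inv _ (isUnit_iff_ne_zero.mpr hMC)
    rw [hinv, Matrix.mul_smul, Matrix.smul_mul, smul_comm]
    refine hpos.smul ?_
    rw [← Complex.ofReal_natCast, ← Complex.ofReal_inv]
    exact Complex.zero_lt_real.mpr (inv_pos.mpr (Nat.cast_pos.mpr hn))
end

section
/- Let Ω be an algebraically closed field of characteristic different from 2, and let ν ∈ Ω satisfy ν² = ν + 15. Define F(x,y,z) := (5ν+17)x⁴ − (14ν+48)x²y² + (8ν+28)x²yz − (4ν+14)x²z² + (10ν+33)y⁴ − (12ν+44)y³z + (2ν+26)y²z² + (4ν−16)yz³ + (ν−6)z⁴. Then for all x, y, z ∈ Ω, if F(x,y,z) = 0 and all three partial derivatives ∂F/∂x, ∂F/∂y, ∂F/∂z vanish at (x,y,z), then x = y = z = 0. In other words, the projective plane quartic curve F = 0 over Ω is smooth. -/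
open MvPolynomial

/-- The homogeneous quartic `F` of Theorem 1.1, as a polynomial in `x = X 0`, `y = X 1`,
`z = X 2` over a ring containing an element `ν` (with `ν² = ν + 15` in the application). -/
noncomputable def quarticF {Ω : Type*} [CommRing Ω] (ν : Ω) : MvPolynomial (Fin 3) Ω :=
  C (5 * ν + 17) * X 0 ^ 4 - C (14 * ν + 48) * X 0 ^ 2 * X 1 ^ 2
    + C (8 * ν + 28) * X 0 ^ 2 * X 1 * X 2 - C (4 * ν + 14) * X 0 ^ 2 * X 2 ^ 2
    + C (10 * ν + 33) * X 1 ^ 4 - C (12 * ν + 44) * X 1 ^ 3 * X 2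
    + C (2 * ν + 26) * X 1 ^ 2 * X 2 ^ 2 + C (4 * ν - 16) * X 1 * X 2 ^ 3
    + C (ν - 6) * X 2 ^ 4

/-- Away from characteristic two, a power of two times a fifth power vanishes only if the base of
the fifth power does. -/
lemma eq_zero_of_two_pow_mul_pow_five {k : Type*} [Field k] (h2 : (2 : k) ≠ 0) (n : ℕ) {t : k}
    (h : 2 ^ n * t ^ 5 = 0) : t = 0 :=
  eq_zero_of_pow_eq_zero ((mul_eq_zero.mp h).resolve_left (pow_ne_zero n h2))

/-- The partial derivatives of `quarticF ν (0, y, z)`, divided by `4`, have no nontrivial common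
zero. -/
lemma eq_zero_of_pderiv_restriction {k : Type*} [Field k] (h2 : (2 : k) ≠ 0) {ν y z : k}
    (hν : ν ^ 2 = ν + 15)
    (hy : (10 * ν + 33) * y ^ 3 - (9 * ν + 33) * y ^ 2 * z + (ν + 13) * y * z ^ 2
      + (ν - 4) * z ^ 3 = 0)
    (hz : -(3 * ν + 11) * y ^ 3 + (ν + 13) * y ^ 2 * z + (3 * ν - 12) * y * z ^ 2
      + (ν - 6) * z ^ 3 = 0) :
    y = 0 ∧ z = 0 := by
  refine ⟨eq_zero_of_two_pow_mul_pow_five h2 10 ?_, eq_zero_of_two_pow_mul_pow_five h2 10 ?_⟩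
  · linear_combination
      ((127 * ν - 379) * y ^ 2 + (43 * ν - 192) * y * z - 15 * z ^ 2) * hy
      + ((96 * ν + 109) * y ^ 2 - (50 * ν - 53) * y * z - (2 * ν - 5) * z ^ 2) * hz
      + (-982 * y ^ 5 + 467 * y ^ 4 * z + 16 * y ^ 3 * z ^ 2 - 114 * y ^ 2 * z ^ 3
        + 13 * y * z ^ 4 + 2 * z ^ 5) * hν
  · linear_combination
      (-(660 * ν + 2249) * y ^ 2 + (317 * ν + 1103) * y * z + (143 * ν + 404) * z ^ 2) * hy
      + (-(2101 * ν + 7152) * y ^ 2 + (1489 * ν + 5070) * y * z - (43 * ν + 190) * z ^ 2) * hz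
      + (297 * y ^ 5 - 2542 * y ^ 4 * z + 6768 * y ^ 3 * z ^ 2 - 693 * y ^ 2 * z ^ 3
        - 1820 * y * z ^ 4 - 100 * z ^ 5) * hν

/-- The partial derivatives of `y³z + νy²z² - (ν - 1)yz³ + z⁴`, which is up to a unit and a power
of two the discriminant of `quarticF ν` as a quadratic polynomial in `x²`, have no nontrivial common
zero. -/
lemma eq_zero_of_pderiv_discriminant {k : Type*} [Field k] (h2 : (2 : k) ≠ 0) {ν y z : k}
    (hν : ν ^ 2 = ν + 15)
    (hy : 3 * y ^ 2 * z + 2 * ν * y * z ^ 2 - (ν - 1) * z ^ 3 = 0)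
    (hz : y ^ 3 + 2 * ν * y ^ 2 * z - (3 * ν - 3) * y * z ^ 2 + 4 * z ^ 3 = 0) :
    y = 0 ∧ z = 0 := by
  refine ⟨eq_zero_of_two_pow_mul_pow_five h2 7 ?_, eq_zero_of_two_pow_mul_pow_five h2 7 ?_⟩
  · linear_combination
      (-(117 * ν + 32) * y ^ 2 + (113 * ν + 99) * y * z - (16 * ν + 156) * z ^ 2) * hy
      + (128 * y ^ 2 + (95 * ν + 96) * y * z - (39 * ν + 21) * z ^ 2) * hz
      + (44 * y ^ 3 * z ^ 2 + 20 * y ^ 2 * z ^ 3 + 28 * y * z ^ 4 - 16 * z ^ 5) * hν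
  · linear_combination
      (-(ν + 3) * y ^ 2 - (8 * ν + 33) * y * z + (4 * ν + 32) * z ^ 2) * hy
      + ((3 * ν + 9) * y * z + (8 * ν + 39) * z ^ 2) * hz
      + (-4 * y ^ 3 * z ^ 2 + 8 * y ^ 2 * z ^ 3 + 8 * y * z ^ 4 + 4 * z ^ 5) * hν

/-- Over an algebraically closed field `Ω` of characteristic different from 2
containing `ν` with `ν² = ν + 15`, the projective plane quartic `F = 0` is smooth: any common
zero of `F` and its three partial derivatives is `(0, 0, 0)`. -/
theorem stmt_5 (Ω : Type*) [Field Ω] [IsAlgClosed Ω] (h2 : (2 : Ω) ≠ 0)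
    (ν : Ω) (hν : ν ^ 2 = ν + 15) (x y z : Ω)
    (h0 : MvPolynomial.eval ![x, y, z] (quarticF ν) = 0)
    (hd : ∀ i : Fin 3, MvPolynomial.eval ![x, y, z] (MvPolynomial.pderiv i (quarticF ν)) = 0) :
    x = 0 ∧ y = 0 ∧ z = 0 := by
  have hdx := hd 0
  have hdy := hd 1
  have hdz := hd 2
  simp [quarticF, Derivation.leibniz, Derivation.leibniz_pow, pderiv_X] at hdx hdy hdz
  by_cases hx : x = 0
  · subst hx
    refine ⟨rfl, eq_zero_of_pderiv_restriction h2 hν ?_ ?_⟩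
    · refine (mul_eq_zero.mp ?_).resolve_left (pow_ne_zero 2 h2)
      linear_combination hdy
    · refine (mul_eq_zero.mp ?_).resolve_left (pow_ne_zero 2 h2)
      linear_combination hdz
  · have hq : (5 * ν + 17) * x ^ 2
        + (-(7 * ν + 24) * y ^ 2 + (4 * ν + 14) * y * z - (2 * ν + 7) * z ^ 2) = 0 := by
      refine (mul_eq_zero.mp ?_).resolve_left (mul_ne_zero (pow_ne_zero 2 h2) hx)
      linear_combination hdx
    have hp : x ^ 2 = (ν - 3) * y ^ 2 - (2 * ν - 8) * y * z + (ν - 4) * z ^ 2 := by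
      linear_combination (5 * ν - 22) * hq
        + (-25 * x ^ 2 + 35 * y ^ 2 - 20 * y * z + 10 * z ^ 2) * hν
    obtain ⟨rfl, rfl⟩ : y = 0 ∧ z = 0 := by
      refine eq_zero_of_pderiv_discriminant h2 hν ?_ ?_
      · refine (mul_eq_zero.mp ?_).resolve_left (pow_ne_zero 3 h2)
        linear_combination -hdy
          - 2 * (5 * ν + 17) * ((2 * ν - 6) * y - (2 * ν - 8) * z) * hp
          + (20 * x ^ 2 * y - 20 * x ^ 2 * z - (20 * ν - 32) * y ^ 3
            + (60 * ν - 156) * y ^ 2 * z - (60 * ν - 196) * y * z ^ 2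
            + (20 * ν - 72) * z ^ 3) * hν
      · refine (mul_eq_zero.mp ?_).resolve_left (pow_ne_zero 3 h2)
        linear_combination -hdz
          - 2 * (5 * ν + 17) * (-(2 * ν - 8) * y + (2 * ν - 8) * z) * hp
          + (-20 * x ^ 2 * y + 20 * x ^ 2 * z + (20 * ν - 52) * y ^ 3
            - (60 * ν - 196) * y ^ 2 * z + (60 * ν - 216) * y * z ^ 2
            - (20 * ν - 72) * z ^ 3) * hν
    exact absurd (eq_zero_of_pow_eq_zero (n := 2) (by linear_combination hp)) hx
end

section
/- Let Ω be an algebraically closed field of characteristic 2, and let ν ∈ Ω satisfy ν² = ν + 15 (equivalently ν² = ν + 1 in Ω). Define F(x,y,z) := (5ν+17)x⁴ − (14ν+48)x²y² + (8ν+28)x²yz − (4ν+14)x²z² + (10ν+33)y⁴ − (12ν+44)y³z + (2ν+26)y²z² + (4ν−16)yz³ + (ν−6)z⁴ over Ω. Then there exist x, y, z ∈ Ω, not all zero, such that F(x,y,z) = 0 and all three partial derivatives ∂F/∂x, ∂F/∂y, ∂F/∂z vanish at (x,y,z). In other words, the plane quartic F = 0 is singular in characteristic 2. -/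
open MvPolynomial

/-- In characteristic 2 the quartic `F` has only fourth powers of the variables left. -/
theorem quarticF_eq_of_charP_two {R : Type*} [CommRing R] [CharP R 2] (ν : R) :
    quarticF ν = C (ν + 1) * X 0 ^ 4 + X 1 ^ 4 + C ν * X 2 ^ 4 := by
  have h : (2 : MvPolynomial (Fin 3) R) = 0 := CharTwo.two_eq_zero
  simp only [quarticF, map_add, map_sub, map_mul, map_ofNat, map_one]
  linear_combination
    ((2 * C ν + 8) * X 0 ^ 4 - (7 * C ν + 24) * X 0 ^ 2 * X 1 ^ 2
      + (4 * C ν + 14) * X 0 ^ 2 * X 1 * X 2 - (2 * C ν + 7) * X 0 ^ 2 * X 2 ^ 2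
      + (5 * C ν + 16) * X 1 ^ 4 - (6 * C ν + 22) * X 1 ^ 3 * X 2
      + (C ν + 13) * X 1 ^ 2 * X 2 ^ 2 + (2 * C ν - 8) * X 1 * X 2 ^ 3
      - 3 * X 2 ^ 4) * h

/-- In characteristic 2 all partial derivatives of `F` vanish identically. -/
theorem pderiv_quarticF_of_charP_two {R : Type*} [CommRing R] [CharP R 2] (ν : R) (i : Fin 3) :
    pderiv i (quarticF ν) = 0 := by
  have h : (4 : MvPolynomial (Fin 3) R) = 0 := by
    linear_combination 2 * (CharTwo.two_eq_zero : (2 : MvPolynomial (Fin 3) R) = 0)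
  simp [quarticF_eq_of_charP_two, h]

/-- Over an algebraically closed field `Ω` of characteristic 2 containing `ν`
with `ν² = ν + 15`, the plane quartic `F = 0` is singular: there is a nonzero common zero
of `F` and its three partial derivatives. -/
theorem stmt_6 (Ω : Type*) [Field Ω] [IsAlgClosed Ω] [CharP Ω 2]
    (ν : Ω) (hν : ν ^ 2 = ν + 15) :
    ∃ x y z : Ω, ¬(x = 0 ∧ y = 0 ∧ z = 0) ∧
      MvPolynomial.eval ![x, y, z] (quarticF ν) = 0 ∧
      ∀ i : Fin 3, MvPolynomial.eval ![x, y, z] (MvPolynomial.pderiv i (quarticF ν)) = 0 := by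
  obtain ⟨y, hy⟩ := IsAlgClosed.exists_pow_nat_eq (-(ν + 1)) (n := 4) (by norm_num)
  refine ⟨1, y, 0, by simp, ?_, fun i ↦ by rw [pderiv_quarticF_of_charP_two, map_zero]⟩
  simp [quarticF_eq_of_charP_two, hy]
end

section
/- Let K = ℚ(√61) and ν = (1+√61)/2 ∈ K, so that ν² = ν + 15. Then the cubic polynomial p₀(t) = t³ + νt² + (1−ν)t + 1 ∈ K[t] is irreducible over K, and its splitting field has degree 6 over K. -/
open Polynomial

/-- An irreducible cubic over a field of characteristic zero whose discriminant is not a square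
has a splitting field of degree 6. -/
theorem Cubic.finrank_splittingField_eq_six {F : Type*} [Field F] [CharZero F] (P : Cubic F)
    (ha : P.a ≠ 0) (hirr : Irreducible P.toPoly) (hd : ¬ IsSquare P.discr) :
    Module.finrank F P.toPoly.SplittingField = 6 := by
  set L := P.toPoly.SplittingField
  have hdeg : P.toPoly.natDegree = 3 := Cubic.natDegree_of_a_ne_zero ha
  have hcard := Gal.card_of_separable hirr.separable
  have h3 : 3 ∣ Module.finrank F L := by
    have := Gal.prime_degree_dvd_card hirr (by rw [hdeg]; exact Nat.prime_three)
    rwa [hdeg, hcard] at this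
  have hsplit : (P.toPoly.map (algebraMap F L)).Splits := SplittingField.splits _
  have h2 : 2 ∣ Module.finrank F L := by
    obtain ⟨x, y, z, hroots⟩ := (Cubic.splits_iff_roots_eq_three ha).mp hsplit
    have hdisc := Cubic.discr_eq_prod_three_roots ha hroots
    set δ : L := algebraMap F L P.a * algebraMap F L P.a * (x - y) * (x - z) * (y - z)
    have hmin : X ^ 2 - C P.discr = minpoly F δ := by
      refine minpoly.eq_of_irreducible_of_monic ?_ ?_ (monic_X_pow_sub_C _ two_ne_zero)
      · exact (X_pow_sub_C_irreducible_iff_of_prime Nat.prime_two).mpr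
          fun b hb ↦ hd ⟨b, by rw [← hb, sq]⟩
      · simp [hdisc]
    have := minpoly.degree_dvd (K := F) (L := L) (x := δ) (Algebra.IsIntegral.isIntegral δ)
    rwa [← hmin, natDegree_X_pow_sub_C] at this
  have h6 : Module.finrank F L ∣ 6 := by
    classical
    have : Fact (P.toPoly.map (algebraMap F L)).Splits := ⟨hsplit⟩
    have := Subgroup.card_dvd_of_injective _ (Gal.galActionHom_injective P.toPoly L)
    rwa [hcard, Nat.card_perm, Nat.card_eq_fintype_card,
      card_rootSet_eq_natDegree hirr.separable hsplit, hdeg] at this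
  exact Nat.dvd_antisymm h6 (Nat.Coprime.mul_dvd_of_dvd_of_dvd (by norm_num) h2 h3)

/-- The homogenized `1` and `ν` coordinates of `t³ + νt² + (1-ν)t + 1` at `t = (v + wν)/d`, where
`ν² = ν + 15`, have no nontrivial common zero modulo 5. -/
theorem eq_zero_of_coordinates_eq_zero_zmod_five : ∀ v w d : ZMod 5,
    v ^ 3 + 45 * v * w ^ 2 + 15 * w ^ 3 + 30 * v * w * d + 15 * w ^ 2 * d + d ^ 2 * v
      - 15 * d ^ 2 * w + d ^ 3 = 0 →
    3 * v ^ 2 * w + 3 * v * w ^ 2 + 16 * w ^ 3 + d * (v ^ 2 + 2 * v * w + 16 * w ^ 2)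
      - d ^ 2 * v = 0 →
    v = 0 ∧ w = 0 ∧ d = 0 := by
  decide

theorem eq_zero_of_coordinates_eq_zero_int (n : ℕ) : ∀ v w d : ℤ, d.natAbs = n →
    v ^ 3 + 45 * v * w ^ 2 + 15 * w ^ 3 + 30 * v * w * d + 15 * w ^ 2 * d + d ^ 2 * v
      - 15 * d ^ 2 * w + d ^ 3 = 0 →
    3 * v ^ 2 * w + 3 * v * w ^ 2 + 16 * w ^ 3 + d * (v ^ 2 + 2 * v * w + 16 * w ^ 2)
      - d ^ 2 * v = 0 →
    d = 0 := by
  induction n using Nat.strong_induction_on with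
  | _ n ih =>
    intro v w d hn hA hB
    by_contra hd
    have hA' := congrArg (Int.cast : ℤ → ZMod 5) hA
    have hB' := congrArg (Int.cast : ℤ → ZMod 5) hB
    push_cast at hA' hB'
    obtain ⟨hv, hw, hd5⟩ := eq_zero_of_coordinates_eq_zero_zmod_five _ _ _ hA' hB'
    obtain ⟨v, rfl⟩ := (ZMod.intCast_zmod_eq_zero_iff_dvd v 5).mp hv
    obtain ⟨w, rfl⟩ := (ZMod.intCast_zmod_eq_zero_iff_dvd w 5).mp hw
    obtain ⟨d, rfl⟩ := (ZMod.intCast_zmod_eq_zero_iff_dvd d 5).mp hd5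
    push_cast at *
    exact hd (by rw [ih d.natAbs (by omega) v w d rfl (by linarith) (by linarith), mul_zero])

section QuadraticField

variable {K : Type*} [Field K] [CharZero K] {ν : K}

theorem eq_zero_of_add_mul_eq_zero (hν : ν ^ 2 = ν + 15) {a b : ℚ}
    (h : (a : K) + b * ν = 0) : a = 0 ∧ b = 0 := by
  have hb : b = 0 := by
    by_contra hb
    have hnorm : a ^ 2 + a * b - 15 * b ^ 2 = 0 := by
      have : (a : K) ^ 2 + a * b - 15 * b ^ 2 = 0 := by
        linear_combination (a + b - b * ν) * h + (b : K) ^ 2 * hν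
      exact_mod_cast this
    have hsq : IsSquare (61 : ℚ) :=
      ⟨(2 * a + b) / b, by field_simp; linear_combination -4 * hnorm⟩
    revert hsq
    decide +kernel
  subst hb
  exact ⟨by simpa using h, rfl⟩

theorem exists_eq_add_mul (hdeg : Module.finrank ℚ K = 2) (hν : ν ^ 2 = ν + 15) (r : K) :
    ∃ a b : ℚ, r = a + b * ν := by
  have hli : LinearIndependent ℚ ![1, ν] := by
    refine LinearIndependent.pair_iff.mpr fun s t h ↦ eq_zero_of_add_mul_eq_zero hν ?_
    simpa [Rat.smul_def] using h
  have : FiniteDimensional ℚ K := Module.finite_of_finrank_pos (by omega)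
  have hspan := hli.span_eq_top_of_card_eq_finrank' (by simp [hdeg])
  have hr : r ∈ Submodule.span ℚ (Set.range ![1, ν]) := hspan ▸ Submodule.mem_top
  rw [Matrix.range_cons, Matrix.range_cons, Matrix.range_empty, Set.union_empty,
    Set.singleton_union, Submodule.mem_span_pair] at hr
  obtain ⟨a, b, rfl⟩ := hr
  exact ⟨a, b, by simp [Rat.smul_def]⟩

theorem cubic_ne_zero (hdeg : Module.finrank ℚ K = 2) (hν : ν ^ 2 = ν + 15) (r : K) :
    r ^ 3 + ν * r ^ 2 + (1 - ν) * r + 1 ≠ 0 := by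
  intro hr
  obtain ⟨a, b, rfl⟩ := exists_eq_add_mul hdeg hν r
  obtain ⟨d, hd, v, w, rfl, rfl⟩ : ∃ d : ℤ, d ≠ 0 ∧ ∃ v w : ℤ, a = v / d ∧ b = w / d := by
    refine ⟨a.den * b.den, by simp, a.num * b.den, b.num * a.den, ?_, ?_⟩
    · conv_lhs => rw [← Rat.num_div_den a]
      push_cast
      field_simp
    · conv_lhs => rw [← Rat.num_div_den b]
      push_cast
      field_simp
  have hdK : (d : K) ≠ 0 := by exact_mod_cast hd
  push_cast at hr
  field_simp at hr
  obtain ⟨hA, hB⟩ := eq_zero_of_add_mul_eq_zero hν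
    (a := v ^ 3 + 45 * v * w ^ 2 + 15 * w ^ 3 + 30 * v * w * d + 15 * w ^ 2 * d + d ^ 2 * v
      - 15 * d ^ 2 * w + d ^ 3)
    (b := 3 * v ^ 2 * w + 3 * v * w ^ 2 + 16 * w ^ 3 + d * (v ^ 2 + 2 * v * w + 16 * w ^ 2)
      - d ^ 2 * v) (by
      push_cast
      linear_combination hr - (3 * v * w ^ 2 + w ^ 3 * (ν + 1) + 2 * v * w * d
        + w ^ 2 * d * (ν + 1) - d ^ 2 * w) * hν)
  exact hd (eq_zero_of_coordinates_eq_zero_int _ v w d rfl (by exact_mod_cast hA)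
    (by exact_mod_cast hB))

theorem not_isSquare_neg_two_hundred_fifty_six (hdeg : Module.finrank ℚ K = 2)
    (hν : ν ^ 2 = ν + 15) : ¬ IsSquare (-256 : K) := by
  rintro ⟨z, hz⟩
  obtain ⟨a, b, rfl⟩ := exists_eq_add_mul hdeg hν z
  obtain ⟨h, -⟩ := eq_zero_of_add_mul_eq_zero hν (a := a ^ 2 + 15 * b ^ 2 + 256)
    (b := 2 * a * b + b ^ 2) (by push_cast; linear_combination -hz - (b : K) ^ 2 * hν)
  nlinarith [sq_nonneg a, sq_nonneg b]

end QuadraticField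

/-- Let `K = ℚ(√61)` (a number field of degree 2 containing
`ν = (1+√61)/2` with `ν² = ν + 15`). The cubic `p₀(t) = t³ + νt² + (1−ν)t + 1`
is irreducible over `K`, and its splitting field has degree 6 over `K`. -/
theorem stmt_9 (K : Type*) [Field K] [NumberField K]
    (hdeg : Module.finrank ℚ K = 2)
    (ν : K) (hν : ν ^ 2 = ν + 15)
    (p₀ : Polynomial K)
    (hp₀ : p₀ = X ^ 3 + C ν * X ^ 2 + C (1 - ν) * X + C 1) :
    Irreducible p₀ ∧ Module.finrank K p₀.SplittingField = 6 := by
  let P : Cubic K := ⟨1, ν, 1 - ν, 1⟩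
  have hP : p₀ = P.toPoly := by simp [hp₀, P, Cubic.toPoly]
  have ha : P.a ≠ 0 := one_ne_zero
  have hnat : P.toPoly.natDegree = 3 := Cubic.natDegree_of_a_ne_zero ha
  have hirr : Irreducible P.toPoly := by
    rw [irreducible_iff_roots_eq_zero_of_degree_le_three (by omega) (by omega)]
    refine Multiset.eq_zero_of_forall_notMem fun r hr ↦ cubic_ne_zero hdeg hν r ?_
    simpa [P, Cubic.toPoly] using (mem_roots'.mp hr).2
  have hdiscr : P.discr = -256 := by
    simp only [P, Cubic.discr]
    linear_combination (ν ^ 2 - ν - 15) * hν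
  rw [hP]
  refine ⟨hirr, P.finrank_splittingField_eq_six ha hirr ?_⟩
  rw [hdiscr]
  exact not_isSquare_neg_two_hundred_fifty_six hdeg hν
end

section
/- The polynomial p₆(x) = x⁶ + x⁵ − 7x⁴ + 14x² − 16x + 4 is irreducible over ℚ, and its splitting field over ℚ has degree 12 over ℚ. -/
open Polynomial IntermediateField

lemma Polynomial.natDegree_dvd_finrank_of_not_isRoot {K L : Type*} [Field K] [Field L]
    [Algebra K L] {q : K[X]} (hdeg : q.natDegree ∈ Finset.Icc 1 3) (hroot : ∀ x, ¬ q.IsRoot x)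
    {y : L} (hy : aeval y q = 0) : q.natDegree ∣ Module.finrank K L := by
  have hirr := irreducible_of_degree_le_three_of_not_isRoot hdeg hroot
  have hx_int : IsIntegral K y := (isAlgebraic_iff_isIntegral).mp ⟨q, hirr.ne_zero, hy⟩
  have hmin := minpoly.Irreducible.eq_minpoly hirr hy
  rw [hmin, natDegree_C_mul (leadingCoeff_ne_zero.mpr hirr.ne_zero)]
  exact minpoly.degree_dvd hx_int

lemma Rat.sq_ne_sixtyOne (x : ℚ) : x ^ 2 ≠ 61 := by
  intro h
  have h61 : ¬ IsSquare (61 : ℚ) := by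
    rw [Rat.isSquare_iff]
    rintro ⟨⟨r, hr⟩, -⟩
    norm_num at hr
    have : r ≤ 7 := by nlinarith
    have : -7 ≤ r := by nlinarith
    interval_cases r <;> omega
  exact h61 ⟨x, by rw [← h]; ring⟩

lemma Rat.cubic_ne_zero (x : ℚ) : x ^ 3 + 3 * x ^ 2 + 4 * x - 4 ≠ 0 := by
  intro h
  have hx_int : IsIntegral ℤ x := by
    refine ⟨X ^ 3 + 3 * X ^ 2 + 4 * X - 4, by monicity!, ?_⟩
    simpa [eval₂_sub] using h
  obtain ⟨n, rfl⟩ := IsIntegrallyClosed.isIntegral_iff.mp hx_int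
  have hn : n ^ 3 + 3 * n ^ 2 + 4 * n - 4 = 0 := by
    have : (n : ℚ) ^ 3 + 3 * n ^ 2 + 4 * n - 4 = 0 := by simpa using h
    exact_mod_cast this
  have h0 : 0 < n := by nlinarith [sq_nonneg (n + 1), sq_nonneg n]
  have h1 : n < 1 := by nlinarith [sq_nonneg (n + 1), sq_nonneg n]
  omega

lemma mem_of_sub_sq_add_sq_eq_zero {L : Type*} [Field L] {K : Subfield L}
    {x u v i : L} (hi : i ^ 2 = -1) (hiK : i ∈ K) (hu : u ∈ K) (hv : v ∈ K)
    (h : (x - u) ^ 2 + v ^ 2 = 0) : x ∈ K := by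
  have hfac : (x - (u + i * v)) * (x - (u - i * v)) = 0 := by
    linear_combination h - v ^ 2 * hi
  rcases mul_eq_zero.mp hfac with h | h
  · exact sub_eq_zero.mp h ▸ add_mem hu (mul_mem hiK hv)
  · exact sub_eq_zero.mp h ▸ sub_mem hu (mul_mem hiK hv)

section Sextic

variable {L : Type*} [Field L] [CharZero L] {a : L}

/-- An extension of `ℚ` containing a root of the sextic contains `√61` and a root of an
irreducible rational cubic. -/
lemma six_dvd_finrank_of_sextic_root
    (ha : a ^ 6 + a ^ 5 - 7 * a ^ 4 + 14 * a ^ 2 - 16 * a + 4 = 0) :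
    6 ∣ Module.finrank ℚ L := by
  have h2 : 2 ∣ Module.finrank ℚ L := by
    have hdeg : (X ^ 2 - 61 : ℚ[X]).natDegree = 2 := by compute_degree!
    rw [← hdeg]
    refine natDegree_dvd_finrank_of_not_isRoot (by simp [hdeg])
      (fun x hx ↦ Rat.sq_ne_sixtyOne x ?_)
      (y := 2 * a ^ 5 + 3 * a ^ 4 - 13 * a ^ 3 - 7 * a ^ 2 + 30 * a - 17) ?_
    · simpa [sub_eq_zero] using hx
    · simp only [map_sub, map_pow, aeval_X, map_ofNat]
      linear_combination (57 - 27 * a - 23 * a ^ 2 + 8 * a ^ 3 + 4 * a ^ 4) * ha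
  have h3 : 3 ∣ Module.finrank ℚ L := by
    have hdeg : (X ^ 3 + 3 * X ^ 2 + 4 * X - 4 : ℚ[X]).natDegree = 3 := by compute_degree!
    rw [← hdeg]
    refine natDegree_dvd_finrank_of_not_isRoot (by simp [hdeg])
      (fun x hx ↦ Rat.cubic_ne_zero x ?_) (y := a ^ 3 - 4 * a + 2) ?_
    · simpa using hx
    · simp only [map_sub, map_add, map_mul, map_pow, aeval_X, map_ofNat]
      linear_combination (6 - 4 * a - a ^ 2 + a ^ 3) * ha
  omega

/-- Over an extension containing a root `a` of the sextic, it splits into two linear and two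
quadratic factors, the latter with discriminants that are `-1` up to squares. -/
lemma sextic_factorization
    (ha : a ^ 6 + a ^ 5 - 7 * a ^ 4 + 14 * a ^ 2 - 16 * a + 4 = 0) (x : L) :
    x ^ 6 + x ^ 5 - 7 * x ^ 4 + 14 * x ^ 2 - 16 * x + 4 =
      ((x - a) * ((x - (-9/2 + 7*a - 7/4*a^2 - 13/4*a^3 + 3/4*a^4 + 1/2*a^5)) ^ 2 +
          (1/2 - 3/2*a + 5/4*a^2 + 1/4*a^3 - 1/4*a^4) ^ 2)) *
      ((x - (4 - 7*a + a^2 + 7/2*a^3 - 1/2*a^4 - 1/2*a^5)) *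
        ((x - (2 - 4*a + 5/4*a^2 + 3/2*a^3 - 1/2*a^4 - 1/4*a^5)) ^ 2 +
          (1 - 1/2*a - 5/4*a^2 + 1/4*a^3 + 1/4*a^4) ^ 2)) := by
  have e₁ : (x - a) * ((x - (-9/2 + 7*a - 7/4*a^2 - 13/4*a^3 + 3/4*a^4 + 1/2*a^5)) ^ 2 +
        (1/2 - 3/2*a + 5/4*a^2 + 1/4*a^3 - 1/4*a^4) ^ 2) =
      x ^ 3 - (-9 + 15*a - 7/2*a^2 - 13/2*a^3 + 3/2*a^4 + a^5) * x ^ 2 + 4 * x - 2 := by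
    linear_combination
      (x * (33/8 - 15/8*a - 11/8*a^2 + 1/2*a^3 + 1/4*a^4) -
        (a * (25/8 - 15/8*a - 11/8*a^2 + 1/2*a^3 + 1/4*a^4) - 1/2)) * ha
  have e₂ : (x - (4 - 7*a + a^2 + 7/2*a^3 - 1/2*a^4 - 1/2*a^5)) *
        ((x - (2 - 4*a + 5/4*a^2 + 3/2*a^3 - 1/2*a^4 - 1/4*a^5)) ^ 2 +
          (1 - 1/2*a - 5/4*a^2 + 1/4*a^3 + 1/4*a^4) ^ 2) =
      x ^ 3 - (8 - 15*a + 7/2*a^2 + 13/2*a^3 - 3/2*a^4 - a^5) * x ^ 2 + 4 * x - 2 := by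
    linear_combination
      (x * (17/4 - 9/4*a - 27/16*a^2 + 11/16*a^3 + 5/16*a^4) -
        ((4 - 7*a + a^2 + 7/2*a^3 - 1/2*a^4 - 1/2*a^5) *
            (3/4 - 1/2*a - 3/16*a^2 + 3/16*a^3 + 1/16*a^4) +
          (3/2 - 1/2*a - 1/2*a^2))) * ha
  rw [e₁, e₂]
  linear_combination (1/4 * x ^ 4 * (57 - 27*a - 23*a^2 + 8*a^3 + 4*a^4)) * ha

/-- A subfield containing a square root of `-1` and one root of the sextic contains all its
roots. -/
lemma sextic_root_mem {K : Subfield L} {i x : L} (hi : i ^ 2 = -1) (hiK : i ∈ K) (haK : a ∈ K)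
    (ha : a ^ 6 + a ^ 5 - 7 * a ^ 4 + 14 * a ^ 2 - 16 * a + 4 = 0)
    (hx : x ^ 6 + x ^ 5 - 7 * x ^ 4 + 14 * x ^ 2 - 16 * x + 4 = 0) : x ∈ K := by
  rw [sextic_factorization ha] at hx
  rcases mul_eq_zero.mp hx with h | h <;> rcases mul_eq_zero.mp h with h | h
  · exact sub_eq_zero.mp h ▸ haK
  · refine mem_of_sub_sq_add_sq_eq_zero hi hiK ?_ ?_ h <;>
      apply_rules [add_mem, sub_mem, neg_mem, div_mem, mul_mem, pow_mem, ofNat_mem, one_mem]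
  · rw [sub_eq_zero.mp h]
    apply_rules [add_mem, sub_mem, neg_mem, div_mem, mul_mem, pow_mem, ofNat_mem, one_mem]
  · refine mem_of_sub_sq_add_sq_eq_zero hi hiK ?_ ?_ h <;>
      apply_rules [add_mem, sub_mem, neg_mem, div_mem, mul_mem, pow_mem, ofNat_mem, one_mem]

/-- A subfield containing all roots of the sextic contains the square roots of `-1`. -/
lemma sqrt_neg_one_mem_of_sextic_roots_mem {K : Subfield L} {i : L} (hi : i ^ 2 = -1)
    (ha : a ^ 6 + a ^ 5 - 7 * a ^ 4 + 14 * a ^ 2 - 16 * a + 4 = 0)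
    (hK : ∀ x : L, x ^ 6 + x ^ 5 - 7 * x ^ 4 + 14 * x ^ 2 - 16 * x + 4 = 0 → x ∈ K) :
    i ∈ K := by
  have haK := hK a ha
  obtain ⟨u, hu⟩ : ∃ u : L, u = -9/2 + 7*a - 7/4*a^2 - 13/4*a^3 + 3/4*a^4 + 1/2*a^5 := ⟨_, rfl⟩
  obtain ⟨v, hv⟩ : ∃ v : L, v = 1/2 - 3/2*a + 5/4*a^2 + 1/4*a^3 - 1/4*a^4 := ⟨_, rfl⟩
  have hz : u + i * v ∈ K := by
    refine hK _ ?_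
    rw [sextic_factorization ha, ← hu, ← hv,
      show (u + i * v - u) ^ 2 + v ^ 2 = 0 by linear_combination v ^ 2 * hi]
    ring
  clear hK
  have huK : u ∈ K := by
    rw [hu]
    apply_rules [add_mem, sub_mem, neg_mem, div_mem, mul_mem, pow_mem, ofNat_mem, one_mem]
  have hiz : i = (u + i * v - u) * (12 - 14*a + a^2 + 7*a^3 - a^4 - a^5) := by
    rw [hv]
    linear_combination (-i * (5/4 - 5/4*a - 1/4*a^2 + 1/4*a^3)) * ha
  rw [hiz]
  refine mul_mem (sub_mem hz huK) ?_
  apply_rules [add_mem, sub_mem, neg_mem, div_mem, mul_mem, pow_mem, ofNat_mem, one_mem]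

end Sextic

lemma irreducible_of_sextic {p : ℚ[X]}
    (hp : p = X ^ 6 + X ^ 5 - C 7 * X ^ 4 + C 14 * X ^ 2 - C 16 * X + C 4) : Irreducible p := by
  have hdeg : p.natDegree = 6 := by rw [hp]; compute_degree!
  have hmonic : p.Monic := by rw [hp]; monicity!
  obtain ⟨z, hz⟩ := IsAlgClosed.exists_aeval_eq_zero ℂ p (by
    rw [degree_eq_natDegree hmonic.ne_zero, hdeg]; norm_num)
  have hx_int : IsIntegral ℚ z := ⟨p, hmonic, hz⟩
  have hgen : (AdjoinSimple.gen ℚ z) ^ 6 + (AdjoinSimple.gen ℚ z) ^ 5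
      - 7 * (AdjoinSimple.gen ℚ z) ^ 4 + 14 * (AdjoinSimple.gen ℚ z) ^ 2
      - 16 * (AdjoinSimple.gen ℚ z) + 4 = 0 := by
    apply (algebraMap ℚ⟮z⟯ ℂ).injective
    simp only [map_add, map_sub, map_mul, map_pow, map_ofNat, map_zero,
      AdjoinSimple.algebraMap_gen]
    simpa [hp] using hz
  have h6 := six_dvd_finrank_of_sextic_root hgen
  rw [adjoin.finrank hx_int] at h6
  have := eq_of_monic_of_dvd_of_natDegree_le (minpoly.monic hx_int) hmonic (minpoly.dvd ℚ z hz)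
    (hdeg ▸ Nat.le_of_dvd (minpoly.natDegree_pos hx_int) h6)
  exact this ▸ minpoly.irreducible hx_int

lemma exists_real_sextic_root :
    ∃ r : ℝ, r ^ 6 + r ^ 5 - 7 * r ^ 4 + 14 * r ^ 2 - 16 * r + 4 = 0 := by
  have := intermediate_value_Icc' (zero_le_one (α := ℝ))
    (f := fun r : ℝ ↦ r ^ 6 + r ^ 5 - 7 * r ^ 4 + 14 * r ^ 2 - 16 * r + 4) (by fun_prop)
  obtain ⟨r, -, hr⟩ := this (show (0 : ℝ) ∈ _ by norm_num)
  exact ⟨r, hr⟩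

/-- A field generated by a real number does not contain `Complex.I`. -/
lemma finrank_adjoin_I_over_adjoin_ofReal (r : ℝ) :
    Module.finrank ℚ⟮(r : ℂ)⟯ (ℚ⟮(r : ℂ)⟯)⟮Complex.I⟯ = 2 := by
  set F := ℚ⟮(r : ℂ)⟯
  have hreal : ∀ z ∈ F, z.im = 0 := by
    have hle : F ≤ (Complex.ofRealAm.restrictScalars ℚ).fieldRange :=
      adjoin_simple_le_iff.mpr ⟨r, rfl⟩
    intro z hz
    obtain ⟨s, rfl⟩ := hle hz
    simp
  have hdeg : (X ^ 2 + 1 : F[X]).natDegree = 2 := by compute_degree!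
  have hmonic : (X ^ 2 + 1 : F[X]).Monic := by monicity!
  have hI : aeval Complex.I (X ^ 2 + 1 : F[X]) = 0 := by simp
  have hirr : Irreducible (X ^ 2 + 1 : F[X]) := by
    refine irreducible_of_degree_le_three_of_not_isRoot (by simp [hdeg]) fun x hx ↦ ?_
    have him := hreal x x.2
    have hsq : (x : ℂ) ^ 2 + 1 = 0 := by
      simpa using congrArg (Subtype.val : F → ℂ) (show x ^ 2 + 1 = 0 by simpa using hx)
    have hre := congrArg Complex.re hsq
    simp [pow_two, him] at hre
    nlinarith
  rw [adjoin.finrank ⟨_, hmonic, hI⟩, ← minpoly.eq_of_irreducible_of_monic hirr hI hmonic, hdeg]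

/-- The splitting field of the sextic inside `ℂ` is generated by `Complex.I` and any root. -/
lemma adjoin_rootSet_sextic {p : ℚ[X]}
    (hp : p = X ^ 6 + X ^ 5 - C 7 * X ^ 4 + C 14 * X ^ 2 - C 16 * X + C 4) {a : ℂ}
    (ha : a ^ 6 + a ^ 5 - 7 * a ^ 4 + 14 * a ^ 2 - 16 * a + 4 = 0) :
    adjoin ℚ (p.rootSet ℂ) = ℚ⟮a, Complex.I⟯ := by
  have hroot : ∀ x : ℂ, x ∈ p.rootSet ℂ ↔
      x ^ 6 + x ^ 5 - 7 * x ^ 4 + 14 * x ^ 2 - 16 * x + 4 = 0 := by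
    intro x
    rw [mem_rootSet_of_ne (irreducible_of_sextic hp).ne_zero, hp]
    simp
  apply le_antisymm
  · rw [adjoin_le_iff]
    exact fun x hx ↦ sextic_root_mem (K := ℚ⟮a, Complex.I⟯.toSubfield) Complex.I_sq
      (subset_adjoin ℚ _ (by simp)) (subset_adjoin ℚ _ (by simp)) ha ((hroot x).mp hx)
  · have hmem := fun x hx ↦ subset_adjoin ℚ (p.rootSet ℂ) ((hroot x).mpr hx)
    rw [adjoin_le_iff, Set.insert_subset_iff, Set.singleton_subset_iff]
    exact ⟨hmem a ha, sqrt_neg_one_mem_of_sextic_roots_mem (K := (adjoin ℚ (p.rootSet ℂ)).toSubfield)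
      Complex.I_sq ha hmem⟩

/-- The polynomial `p₆(x) = x⁶ + x⁵ − 7x⁴ + 14x² − 16x + 4` is irreducible
over `ℚ`, and its splitting field over `ℚ` has degree 12. -/
theorem stmt_10 (p₆ : Polynomial ℚ)
    (hp₆ : p₆ = X ^ 6 + X ^ 5 - C 7 * X ^ 4 + C 14 * X ^ 2 - C 16 * X + C 4) :
    Irreducible p₆ ∧ Module.finrank ℚ p₆.SplittingField = 12 := by
  have hirr := irreducible_of_sextic hp₆
  refine ⟨hirr, ?_⟩
  have hdeg : p₆.natDegree = 6 := by rw [hp₆]; compute_degree!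
  have hmonic : p₆.Monic := by rw [hp₆]; monicity!
  obtain ⟨r, hr⟩ := exists_real_sextic_root
  have ha : (r : ℂ) ^ 6 + (r : ℂ) ^ 5 - 7 * (r : ℂ) ^ 4 + 14 * (r : ℂ) ^ 2 - 16 * (r : ℂ) + 4
      = 0 := by exact_mod_cast hr
  have hroot : aeval (r : ℂ) p₆ = 0 := by simpa [hp₆] using ha
  have hsplit : p₆.IsSplittingField ℚ (adjoin ℚ (p₆.rootSet ℂ)) :=
    adjoin_rootSet_isSplittingField (IsAlgClosed.splits _)
  rw [(IsSplittingField.algEquiv (adjoin ℚ (p₆.rootSet ℂ)) p₆).symm.toLinearEquiv.finrank_eq,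
    adjoin_rootSet_sextic hp₆ ha, ← adjoin_simple_adjoin_simple]
  change Module.finrank ℚ (ℚ⟮(r : ℂ)⟯)⟮Complex.I⟯ = 12
  rw [← Module.finrank_mul_finrank ℚ ℚ⟮(r : ℂ)⟯, finrank_adjoin_I_over_adjoin_ofReal,
    adjoin.finrank ⟨p₆, hmonic, hroot⟩,
    ← minpoly.eq_of_irreducible_of_monic hirr hroot hmonic, hdeg]
end

section
/- The polynomial p₁₂(x) = x¹² − 4x¹¹ + 10x¹⁰ − 44x⁹ + 174x⁸ − 422x⁷ + 618x⁶ − 512x⁵ + 170x⁴ + 56x³ − 58x² + 6x + 9 is irreducible over ℚ, and the number field L := ℚ[x]/(p₁₂) is a Galois extension of ℚ of degree 12. -/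
open Polynomial

/-- The degree-12 polynomial cutting out the field `L` of the Faltings–Serre argument. -/
noncomputable def p12 : Polynomial ℚ :=
  X ^ 12 - C 4 * X ^ 11 + C 10 * X ^ 10 - C 44 * X ^ 9 + C 174 * X ^ 8 - C 422 * X ^ 7
    + C 618 * X ^ 6 - C 512 * X ^ 5 + C 170 * X ^ 4 + C 56 * X ^ 3 - C 58 * X ^ 2
    + C 6 * X + C 9

open IntermediateField

/-- A field of characteristic zero containing a root of `p12` contains elements `i`, `w`, `s` with
`i ^ 2 = -1`, `w ^ 2 = 61` and `s ^ 3 + s ^ 2 - 17 * s + 31 = 0`. -/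
theorem exists_generators_of_eval₂_p12_eq_zero {E : Type*} [Field E] [CharZero E] {φ : ℚ →+* E}
    {a : E} (ha : eval₂ φ a p12 = 0) :
    ∃ i w s : E, i ^ 2 = -1 ∧ w ^ 2 = 61 ∧ s ^ 3 + s ^ 2 - 17 * s + 31 = 0 := by
  have h : a ^ 12 - 4 * a ^ 11 + 10 * a ^ 10 - 44 * a ^ 9 + 174 * a ^ 8 - 422 * a ^ 7
      + 618 * a ^ 6 - 512 * a ^ 5 + 170 * a ^ 4 + 56 * a ^ 3 - 58 * a ^ 2 + 6 * a + 9 = 0 := by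
    simpa [p12, eval₂_mul, map_ofNat] using ha
  refine ⟨
      (92 * a ^ 11 + 1518 * a ^ 10 - 4045 * a ^ 9 + 7750 * a ^ 8 - 50642 * a ^ 7 + 197983 *
        a ^ 6 - 408524 * a ^ 5 + 466846 * a ^ 4 - 246907 * a ^ 3 + 20878 * a ^ 2 + 16718 * a
        - 5541) / 18042,
      (-6029 * a ^ 11 + 19298 * a ^ 10 - 43563 * a ^ 9 + 227726 * a ^ 8 - 861093 * a ^ 7 +
        1813724 * a ^ 6 - 2138439 * a ^ 5 + 1149890 * a ^ 4 + 79511 * a ^ 3 - 284820 * a ^ 2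
        + 88857 * a - 14295) / 9021,
      (51 * a ^ 11 - 177 * a ^ 10 + 422 * a ^ 9 - 2129 * a ^ 8 + 7861 * a ^ 7 - 17948 * a ^
        6 + 25297 * a ^ 5 - 20993 * a ^ 4 + 8266 * a ^ 3 + 1783 * a ^ 2 - 3121 * a - 285) / 291,
      ?_, ?_, ?_⟩
  · linear_combination
      ((8464 * a ^ 10 + 313168 * a ^ 9 + 2728076 * a ^ 8 - 2701580 * a ^ 7 + 4792473 * a ^ 6
        - 64716128 * a ^ 5 + 222246410 * a ^ 4 - 361878202 * a ^ 3 + 291729958 * a ^ 2 -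
        46971834 * a + 39579605) / 325513764) * h
  · linear_combination
      ((36348841 * a ^ 10 - 87299920 * a ^ 9 + 185007368 * a ^ 8 - 1214899980 * a ^ 7 +
        4194538645 * a ^ 6 - 7348609342 * a ^ 5 + 6379653812 * a ^ 4 - 1017539508 * a ^ 3 -
        1673013411 * a ^ 2 + 70304106 * a - 528859764) / 81378441) * h
  · linear_combination
      ((132651 * a ^ 21 - 850527 * a ^ 20 + 3357585 * a ^ 19 - 17241930 * a ^ 18 + 80511615
        * a ^ 17 - 289228761 * a ^ 16 + 900420587 * a ^ 15 - 2679972796 * a ^ 14 +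
        7480248468 * a ^ 13 - 17964064614 * a ^ 12 + 34965711262 * a ^ 11 - 53638021294 * a
        ^ 10 + 63307858623 * a ^ 9 - 55256891297 * a ^ 8 + 31970137667 * a ^ 7 - 7177763692
        * a ^ 6 - 6067300661 * a ^ 5 + 6606280507 * a ^ 4 - 2063441553 * a ^ 3 - 295883920 *
        a ^ 2 + 385219372 * a + 130519344) / 24642171) * h

theorem irreducible_X_sq_sub_sixty_one : Irreducible (X ^ 2 - C 61 : ℚ[X]) := by
  refine X_pow_sub_C_irreducible_of_prime Nat.prime_two fun b hb ↦ ?_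
  have h := (show Nat.Prime 61 by norm_num).irrational_sqrt
  refine h ⟨|b|, ?_⟩
  have hb' : (b : ℝ) ^ 2 = 61 := by exact_mod_cast hb
  push_cast
  rw [← Real.sqrt_sq_eq_abs, hb']

theorem irreducible_X_cube_add_X_sq_sub_seventeen_mul_X_add_thirty_one :
    Irreducible (X ^ 3 + X ^ 2 - C 17 * X + C 31 : ℚ[X]) := by
  have hm : (X ^ 3 + X ^ 2 - C 17 * X + C 31 : ℤ[X]).Monic := by monicity!
  have hmap : (X ^ 3 + X ^ 2 - C 17 * X + C 31 : ℤ[X]).map (algebraMap ℤ ℚ) =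
      X ^ 3 + X ^ 2 - C 17 * X + C 31 := by simp [map_ofNat]
  rw [← hmap, ← hm.irreducible_iff_irreducible_map_fraction_map]
  have key : ∀ y : ZMod 5, y ^ 3 + y ^ 2 - 17 * y + 31 ≠ 0 := by decide
  have : Fact (Nat.Prime 5) := ⟨by norm_num⟩
  refine hm.irreducible_of_irreducible_map (Int.castRingHom (ZMod 5)) _ ?_
  have hd : ((X ^ 3 + X ^ 2 - C 17 * X + C 31 : ℤ[X]).map
      (Int.castRingHom (ZMod 5))).natDegree = 3 := by
    rw [hm.natDegree_map]
    compute_degree!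
  rw [irreducible_iff_roots_eq_zero_of_degree_le_three (by omega) (by omega),
    Multiset.eq_zero_iff_forall_notMem]
  intro x hx
  have hx := (mem_roots'.1 hx).2
  simp only [IsRoot.def, eval_map, eval₂_add, eval₂_sub, eval₂_mul, eval₂_pow, eval₂_X,
    eval₂_C] at hx
  simp only [map_ofNat] at hx
  exact key x hx

/-- A field containing `√-1` and `√61` has degree over `ℚ` divisible by `4`. -/
theorem four_dvd_finrank {E : Type*} [Field E] [Algebra ℚ E] {i w : E}
    (hi : i ^ 2 = -1) (hw : w ^ 2 = 61) : 4 ∣ Module.finrank ℚ E := by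
  have hmw : minpoly ℚ w = X ^ 2 - C 61 :=
    (minpoly.eq_of_irreducible_of_monic irreducible_X_sq_sub_sixty_one (by simp [hw])
      (by monicity!)).symm
  have hiw : IsIntegral ℚ w := ⟨X ^ 2 - C 61, by monicity!, by simp [hw]⟩
  have hK : Module.finrank ℚ ℚ⟮w⟯ = 2 := by
    rw [adjoin.finrank hiw, hmw]
    compute_degree!
  have hno : ∀ b : ℚ⟮w⟯, b ^ 2 ≠ -1 := by
    intro b hb
    let _ : Algebra ℚ ℚ⟮w⟯ := ℚ⟮w⟯.algebra'
    let f := (adjoin.powerBasis hiw).lift (√61 : ℝ) <| by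
      rw [adjoin.powerBasis_gen, minpoly_gen, hmw]
      simp
    have h := congrArg f hb
    simp only [map_pow, map_neg, map_one] at h
    nlinarith [sq_nonneg (f b)]
  have hirr : Irreducible (X ^ 2 - C (-1) : ℚ⟮w⟯[X]) :=
    X_pow_sub_C_irreducible_of_prime Nat.prime_two hno
  have hmi : minpoly ℚ⟮w⟯ i = X ^ 2 - C (-1) :=
    (minpoly.eq_of_irreducible_of_monic hirr (by simp [hi]) (by monicity!)).symm
  have hii : IsIntegral ℚ⟮w⟯ i := ⟨X ^ 2 - C (-1), by monicity!, by simp [hi]⟩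
  have hL : Module.finrank ℚ⟮w⟯ ℚ⟮w⟯⟮i⟯ = 2 := by
    rw [adjoin.finrank hii, hmi]
    compute_degree!
  rw [← Module.finrank_mul_finrank ℚ ℚ⟮w⟯ E, ← Module.finrank_mul_finrank ℚ⟮w⟯ ℚ⟮w⟯⟮i⟯ E, hK, hL]
  exact ⟨_, by ring⟩

/-- A field containing a root of `X ^ 3 + X ^ 2 - 17 * X + 31` has degree over `ℚ` divisible
by `3`. -/
theorem three_dvd_finrank {E : Type*} [Field E] [Algebra ℚ E] {s : E}
    (hs : s ^ 3 + s ^ 2 - 17 * s + 31 = 0) : 3 ∣ Module.finrank ℚ E := by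
  have hs' : aeval s (X ^ 3 + X ^ 2 - C 17 * X + C 31 : ℚ[X]) = 0 := by
    simpa [map_ofNat] using hs
  have hm : (X ^ 3 + X ^ 2 - C 17 * X + C 31 : ℚ[X]).Monic := by monicity!
  have hms := minpoly.eq_of_irreducible_of_monic
    irreducible_X_cube_add_X_sq_sub_seventeen_mul_X_add_thirty_one hs' hm
  have hK : Module.finrank ℚ ℚ⟮s⟯ = 3 := by
    rw [adjoin.finrank ⟨_, hm, hs'⟩, ← hms]
    compute_degree!
  rw [← Module.finrank_mul_finrank ℚ ℚ⟮s⟯ E, hK]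
  exact dvd_mul_right _ _

theorem twelve_dvd_finrank {E : Type*} [Field E] [Algebra ℚ E] {i w s : E}
    (hi : i ^ 2 = -1) (hw : w ^ 2 = 61) (hs : s ^ 3 + s ^ 2 - 17 * s + 31 = 0) :
    12 ∣ Module.finrank ℚ E :=
  Nat.Coprime.mul_dvd_of_dvd_of_dvd (m := 4) (n := 3) (by norm_num)
    (four_dvd_finrank hi hw) (three_dvd_finrank hs)

theorem natDegree_p12 : p12.natDegree = 12 := by
  unfold p12
  compute_degree!

theorem irreducible_p12 : Irreducible p12 := by
  obtain ⟨f, hf, g, hg⟩ := exists_irreducible_of_natDegree_pos (f := p12)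
    (by rw [natDegree_p12]; norm_num)
  have : Fact (Irreducible f) := ⟨hf⟩
  have h0 : p12 ≠ 0 := ne_zero_of_natDegree_gt (n := 0) (by rw [natDegree_p12]; norm_num)
  have hg0 : g ≠ 0 := by
    rintro rfl
    simp [h0] at hg
  have ha : eval₂ (AdjoinRoot.of f) (AdjoinRoot.root f) p12 = 0 := by
    rw [hg, eval₂_mul, AdjoinRoot.eval₂_root, zero_mul]
  have : CharZero (AdjoinRoot f) := charZero_of_injective_ringHom (AdjoinRoot.of f).injective
  obtain ⟨i, w, s, hi, hw, hs⟩ := exists_generators_of_eval₂_p12_eq_zero ha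
  have h12 := twelve_dvd_finrank hi hw hs
  rw [(AdjoinRoot.powerBasis hf.ne_zero).finrank, AdjoinRoot.powerBasis_dim] at h12
  have hle := Nat.le_of_dvd hf.natDegree_pos h12
  have hdeg := natDegree_mul hf.ne_zero hg0
  rw [← hg, natDegree_p12] at hdeg
  have hgu : IsUnit g := isUnit_iff_degree_eq_zero.2 <| by
    rw [degree_eq_natDegree hg0]
    norm_cast
    omega
  rw [hg]
  exact (irreducible_mul_isUnit hgu).2 hf

/-- A field of degree `12` over `ℚ` containing `√-1`, `√61` and a root of
`X ^ 3 + X ^ 2 - 17 * X + 31` is Galois over `ℚ`. -/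
theorem isGalois_of_finrank_eq_twelve {E : Type*} [Field E] [Algebra ℚ E]
    (hE : Module.finrank ℚ E = 12) {i w s : E}
    (hi : i ^ 2 = -1) (hw : w ^ 2 = 61) (hs : s ^ 3 + s ^ 2 - 17 * s + 31 = 0) :
    IsGalois ℚ E := by
  have : CharZero E := algebraRat.charZero E
  have : FiniteDimensional ℚ E := Module.finite_of_finrank_pos (by omega)
  set d : E := i * w * (135 - 50 * s - 13 * s ^ 2) / 122 with hd
  have hd2 : d ^ 2 = 69 - 2 * s - 3 * s ^ 2 := by
    rw [hd]
    linear_combination (w ^ 2 * (135 - 50 * s - 13 * s ^ 2) ^ 2 / 122 ^ 2) * hi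
      - ((135 - 50 * s - 13 * s ^ 2) ^ 2 / 122 ^ 2) * hw - (1131 / 244 + 169 / 244 * s) * hs
  let q : ℚ[X] := (X ^ 2 + C 1) * (X ^ 2 - C 61) * (X ^ 3 + X ^ 2 - C 17 * X + C 31)
  have hq0 : q ≠ 0 := by
    have : q.Monic := by
      unfold q
      monicity!
    exact this.ne_zero
  have hq : q.map (algebraMap ℚ E) = (X - C i) * (X - C (-i)) * ((X - C w) * (X - C (-w))) *
      ((X - C s) * (X - C ((-1 - s + d) / 2)) * (X - C ((-1 - s - d) / 2))) := by
    have h1 : (X - C i) * (X - C (-i)) = X ^ 2 + C 1 := by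
      have := congrArg C hi
      simp only [map_neg, map_pow] at this ⊢
      linear_combination -this
    have h2 : (X - C w) * (X - C (-w)) = X ^ 2 - C 61 := by
      have := congrArg C hw
      simp only [map_neg, map_pow] at this ⊢
      linear_combination -this
    have h3 : (X - C ((-1 - s + d) / 2)) * (X - C ((-1 - s - d) / 2)) =
        X ^ 2 + C (1 + s) * X + C (s ^ 2 + s - 17) := by
      have e1 : (-1 - s + d) / 2 + (-1 - s - d) / 2 = -(1 + s) := by ring
      have e2 : (-1 - s + d) / 2 * ((-1 - s - d) / 2) = s ^ 2 + s - 17 := by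
        linear_combination -hd2 / 4
      have e1 := congrArg C e1
      have e2 := congrArg C e2
      rw [map_add, map_neg] at e1
      rw [map_mul] at e2
      linear_combination -X * e1 + e2
    have h4 : (X - C s) * (X ^ 2 + C (1 + s) * X + C (s ^ 2 + s - 17)) =
        X ^ 3 + X ^ 2 - C 17 * X + C 31 := by
      have := congrArg C hs
      simp only [map_add, map_sub, map_mul, map_pow, map_one, map_zero] at this ⊢
      linear_combination -this
    rw [h1, h2, mul_assoc (X - C s), h3, h4]
    simp [q]
  have hroot : ∀ x : E, aeval x q = 0 → x ∈ adjoin ℚ (q.rootSet E) := fun x hx ↦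
    subset_adjoin _ _ ((mem_rootSet_of_ne hq0).2 hx)
  let K := adjoin ℚ (q.rootSet E)
  have hiK : i ∈ K := hroot i (by simp [q, hi])
  have hwK : w ∈ K := hroot w (by simp [q, hw])
  have hsK : s ∈ K := hroot s (by
    rw [map_mul]
    exact mul_eq_zero_of_right _ (by simpa [map_ofNat] using hs))
  have hK : 12 ∣ Module.finrank ℚ K := @twelve_dvd_finrank K _ K.algebra' ⟨i, hiK⟩ ⟨w, hwK⟩ ⟨s, hsK⟩
    (Subtype.ext hi) (Subtype.ext hw) (Subtype.ext hs)
  have htop : K = ⊤ := by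
    refine eq_of_le_of_finrank_le le_top ?_
    rw [finrank_top', hE]
    exact Nat.le_of_dvd Module.finrank_pos hK
  have : q.IsSplittingField ℚ E := by
    refine isSplittingField_iff_intermediateField.2 ⟨?_, htop⟩
    rw [hq]
    have hX (x : E) : (X - C x).Splits := Splits.X_sub_C x
    exact (((hX _).mul (hX _)).mul ((hX _).mul (hX _))).mul (((hX _).mul (hX _)).mul (hX _))
  have : Normal ℚ E := Normal.of_isSplittingField q
  exact { }

/-- `p₁₂` is irreducible over `ℚ`, and the number field
`L = ℚ[x]/(p₁₂)` is a Galois extension of `ℚ` of degree 12. -/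
theorem stmt_11 :
    Irreducible p12 ∧
    ∀ [Fact (Irreducible p12)],
      Module.finrank ℚ (AdjoinRoot p12) = 12 ∧ IsGalois ℚ (AdjoinRoot p12) := by
  refine ⟨irreducible_p12, ?_⟩
  intro _
  have hdeg : Module.finrank ℚ (AdjoinRoot p12) = 12 := by
    rw [(AdjoinRoot.powerBasis irreducible_p12.ne_zero).finrank, AdjoinRoot.powerBasis_dim,
      natDegree_p12]
  have : CharZero (AdjoinRoot p12) := charZero_of_injective_ringHom (AdjoinRoot.of p12).injective
  obtain ⟨i, w, s, hi, hw, hs⟩ := exists_generators_of_eval₂_p12_eq_zero (AdjoinRoot.eval₂_root p12)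
  exact ⟨hdeg, isGalois_of_finrank_eq_twelve hdeg hi hw hs⟩
end
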